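/- arXiv:1502.00361 — 2 statements merged into one kernel-verified Lean document; each statement's English description precedes it below -/
import Mathlib

section
/- Let F = (X_n, K_n, π_n)_{n≥1} be a family of irreducible birth and death chains on X_n = {0,1,...,n} with inf_{i,n} K_n(i,i) > 0. Let λ_n be the smallest non-zero eigenvalue of I − K_n. For each n choose M_n ∈ X_n with inf_n π_n([0,M_n]) > 0 and inf_n π_n([M_n,n]) > 0, and set θ_n = max{E_0 τ^{(n)}_{M_n}, E_n τ^{(n)}_{M_n}} and β_n² = max{Var_0 τ^{(n)}_{M_n}, Var_n τ^{(n)}_{M_n}}, where τ^{(n)}_i is the discrete-time hitting time. Then F has a maximum total variation cutoff if and only if θ_n λ_n → ∞, if and only if θ_n/β_n → ∞; furthermore, if F has a cutoff, then it has a (θ_n, β_n) maximum total variation cutoff. -/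
open scoped BigOperators
open Filter Matrix Polynomial MeasureTheory

noncomputable section

/-- An irreducible birth and death chain on `{0,1,...,n}`, together with its
(unique) stationary distribution. -/
structure BDChain (n : ℕ) where
  K : Matrix (Fin (n + 1)) (Fin (n + 1)) ℝ
  pi : Fin (n + 1) → ℝ
  K_nonneg : ∀ i j, 0 ≤ K i j
  K_rowSum : ∀ i, ∑ j, K i j = 1
  K_tridiag : ∀ i j : Fin (n + 1), 1 < |(i : ℤ) - (j : ℤ)| → K i j = 0
  K_irred : ∀ i : ℕ, ∀ h : i < n,
    0 < K ⟨i, by omega⟩ ⟨i + 1, by omega⟩ ∧ 0 < K ⟨i + 1, by omega⟩ ⟨i, by omega⟩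
  pi_pos : ∀ i, 0 < pi i
  pi_sum : ∑ i, pi i = 1
  pi_stat : ∀ j, ∑ i, pi i * K i j = pi j

namespace BDChain

variable {n : ℕ}

/-- `π([0,M])` -/
def piLow (c : BDChain n) (M : Fin (n + 1)) : ℝ :=
  ∑ ℓ : Fin (n + 1), if ℓ ≤ M then c.pi ℓ else 0

/-- `π([M,n])` -/
def piHigh (c : BDChain n) (M : Fin (n + 1)) : ℝ :=
  ∑ ℓ : Fin (n + 1), if M ≤ ℓ then c.pi ℓ else 0

/-- `π([a,b])` -/
def piInt (c : BDChain n) (a b : Fin (n + 1)) : ℝ :=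
  ∑ ℓ : Fin (n + 1), if a ≤ ℓ ∧ ℓ ≤ b then c.pi ℓ else 0

/-- The substochastic matrix of the chain killed at state `i`. -/
def killed (c : BDChain n) (i : Fin (n + 1)) : Matrix (Fin (n + 1)) (Fin (n + 1)) ℝ :=
  Matrix.of fun x y => if x = i ∨ y = i then 0 else c.K x y

/-- `P_j(τ_i > m)`, where `τ_i` is the discrete-time hitting time of state `i`. -/
def hitSurv (c : BDChain n) (i j : Fin (n + 1)) (m : ℕ) : ℝ :=
  if j = i then 0 else ∑ y, (c.killed i ^ m) j y

/-- `P_j(τ̃_i > t)`, where `τ̃_i` is the continuous-time hitting time of state `i`. -/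
def hitSurvC (c : BDChain n) (i j : Fin (n + 1)) (t : ℝ) : ℝ :=
  ∑' m : ℕ, (Real.exp (-t) * t ^ m / m.factorial) * c.hitSurv i j m

/-- `E_j τ_i` -/
def hitMean (c : BDChain n) (i j : Fin (n + 1)) : ℝ :=
  ∑' m : ℕ, c.hitSurv i j m

/-- `Var_j τ_i` -/
def hitVar (c : BDChain n) (i j : Fin (n + 1)) : ℝ :=
  (∑' m : ℕ, (2 * (m : ℝ) + 1) * c.hitSurv i j m) - (c.hitMean i j) ^ 2

/-- `E_j τ̃_i` -/
def hitMeanC (c : BDChain n) (i j : Fin (n + 1)) : ℝ :=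
  ∫ t in Set.Ioi (0 : ℝ), c.hitSurvC i j t

/-- `Var_j τ̃_i` -/
def hitVarC (c : BDChain n) (i j : Fin (n + 1)) : ℝ :=
  (∫ t in Set.Ioi (0 : ℝ), 2 * t * c.hitSurvC i j t) - (c.hitMeanC i j) ^ 2

/-- The substochastic matrix of the chain killed at states `i` and `k`. -/
def killed2 (c : BDChain n) (i k : Fin (n + 1)) : Matrix (Fin (n + 1)) (Fin (n + 1)) ℝ :=
  Matrix.of fun x y => if x = i ∨ x = k ∨ y = i ∨ y = k then 0 else c.K x y

/-- `P_j(min{τ_i, τ_k} > m)` -/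
def hitSurv2 (c : BDChain n) (i k j : Fin (n + 1)) (m : ℕ) : ℝ :=
  if j = i ∨ j = k then 0 else ∑ y, (c.killed2 i k ^ m) j y

/-- `E_j min{τ_i, τ_k}` -/
def hitMean2 (c : BDChain n) (i k j : Fin (n + 1)) : ℝ :=
  ∑' m : ℕ, c.hitSurv2 i k j m

/-- `E_j min{τ̃_i, τ̃_k}` -/
def hitMean2C (c : BDChain n) (i k j : Fin (n + 1)) : ℝ :=
  ∫ t in Set.Ioi (0 : ℝ),
    ∑' m : ℕ, (Real.exp (-t) * t ^ m / m.factorial) * c.hitSurv2 i k j m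

/-- The continuous-time kernel `H_t(x,y) = e^{-t(I-K)}(x,y)`. -/
def Ht (c : BDChain n) (t : ℝ) (x y : Fin (n + 1)) : ℝ :=
  ∑' m : ℕ, (Real.exp (-t) * t ^ m / m.factorial) * (c.K ^ m) x y

/-- Discrete-time total variation distance from starting state `x` at time `m`. -/
def dTV (c : BDChain n) (x : Fin (n + 1)) (m : ℕ) : ℝ :=
  ⨆ A : Finset (Fin (n + 1)), (∑ y ∈ A, (c.K ^ m) x y - ∑ y ∈ A, c.pi y)

/-- Continuous-time total variation distance from starting state `x` at time `t`. -/
def dTVC (c : BDChain n) (x : Fin (n + 1)) (t : ℝ) : ℝ :=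
  ⨆ A : Finset (Fin (n + 1)), (∑ y ∈ A, c.Ht t x y - ∑ y ∈ A, c.pi y)

/-- Maximum (over starting states) discrete-time total variation distance. -/
def dTVMax (c : BDChain n) (m : ℕ) : ℝ := ⨆ x, c.dTV x m

/-- Maximum (over starting states) continuous-time total variation distance. -/
def dTVMaxC (c : BDChain n) (t : ℝ) : ℝ := ⨆ x, c.dTVC x t

/-- Discrete-time separation from starting state `x` at time `m`. -/
def sep (c : BDChain n) (x : Fin (n + 1)) (m : ℕ) : ℝ :=
  ⨆ y, (1 - (c.K ^ m) x y / c.pi y)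

/-- Continuous-time separation from starting state `x` at time `t`. -/
def sepC (c : BDChain n) (x : Fin (n + 1)) (t : ℝ) : ℝ :=
  ⨆ y, (1 - c.Ht t x y / c.pi y)

end BDChain

/-- Discrete-time `ε`-mixing time for a distance profile `d`. -/
def mixD (d : ℕ → ℝ) (ε : ℝ) : ℕ := sInf {m : ℕ | d m ≤ ε}

/-- Continuous-time `ε`-mixing time for a distance profile `d`. -/
def mixC (d : ℝ → ℝ) (ε : ℝ) : ℝ := sInf {t : ℝ | 0 ≤ t ∧ d t ≤ ε}

/-- The set of (real) eigenvalues of a square matrix. -/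
def eigSet {ι : Type*} [Fintype ι] (M : Matrix ι ι ℝ) : Set ℝ :=
  {x | ∃ v : ι → ℝ, v ≠ 0 ∧ M.mulVec v = x • v}

/-- `l` is the smallest non-zero eigenvalue of `M`. -/
def IsSmallestNonzeroEig {ι : Type*} [Fintype ι] (M : Matrix ι ι ℝ) (l : ℝ) : Prop :=
  l ∈ eigSet M ∧ l ≠ 0 ∧ ∀ x ∈ eigSet M, x ≠ 0 → l ≤ x

/-- `l` is the smallest eigenvalue of `M`. -/
def IsSmallestEig {ι : Type*} [Fintype ι] (M : Matrix ι ι ℝ) (l : ℝ) : Prop :=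
  l ∈ eigSet M ∧ ∀ x ∈ eigSet M, l ≤ x

/-- The principal submatrix of `I - K` indexed by the states `0, 1, ..., M-1`. -/
def BDChain.subIK {n : ℕ} (c : BDChain n) (M : Fin (n + 1)) :
    Matrix (Fin (M : ℕ)) (Fin (M : ℕ)) ℝ :=
  Matrix.of fun a b =>
    (1 - c.K) (Fin.castLE M.isLt.le a) (Fin.castLE M.isLt.le b)

/-- A family of chains, with `ε ↦ n ↦ T ε n` the mixing time profile, presents a cutoff
with cutoff time `t`. -/
def cutoffWith (T : ℝ → ℕ → ℝ) (t : ℕ → ℝ) : Prop :=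
  ∀ ε ∈ Set.Ioo (0 : ℝ) 1, Filter.Tendsto (fun n => T ε n / t n) Filter.atTop (nhds 1)

/-- A family of chains presents a cutoff. -/
def hasCutoff (T : ℝ → ℕ → ℝ) : Prop :=
  ∃ t : ℕ → ℝ, (∀ n, 0 < t n) ∧ cutoffWith T t

/-- A family of chains presents a `(t_n, b_n)` cutoff. -/
def cutoffWindow (T : ℝ → ℕ → ℝ) (t b : ℕ → ℝ) : Prop :=
  (∀ᶠ n in Filter.atTop, 0 < t n) ∧ (∀ᶠ n in Filter.atTop, 0 < b n) ∧
  Filter.Tendsto (fun n => b n / t n) Filter.atTop (nhds 0) ∧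
  ∀ ε ∈ Set.Ioo (0 : ℝ) 1, ∃ C : ℝ, ∀ᶠ n in Filter.atTop, |T ε n - t n| ≤ C * b n


namespace BDChain

variable {n : ℕ}

/-- The conductance `π(k) p_k` of the edge `{k, k+1}` (zero if `k ≥ n`). -/
def edgeWt (c : BDChain n) (k : ℕ) : ℝ :=
  if h : k < n then c.pi ⟨k, by omega⟩ * c.K ⟨k, by omega⟩ ⟨k + 1, by omega⟩ else 0

/-- The conductance of the edge `{k-1, k}` (zero if `k = 0`). -/
def prevWt (c : BDChain n) : ℕ → ℝ
  | 0 => 0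
  | k + 1 => c.edgeWt k

/-- `π([0,k])` for a natural number `k`. -/
def cum (c : BDChain n) (k : ℕ) : ℝ := ∑ x : Fin (n + 1), if (x : ℕ) ≤ k then c.pi x else 0

/-- The chain seen from the other end: `i ↦ n - i`. -/
def rev (c : BDChain n) : BDChain n where
  K := Matrix.of fun i j => c.K i.rev j.rev
  pi i := c.pi i.rev
  K_nonneg i j := c.K_nonneg _ _
  K_rowSum i := by
    simp only [Matrix.of_apply]
    rw [← c.K_rowSum i.rev]
    exact Equiv.sum_comp Fin.revPerm fun j => c.K i.rev j
  K_tridiag i j h := by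
    apply c.K_tridiag
    simp only [Fin.val_rev]
    have hi := i.isLt
    have hj := j.isLt
    rw [Nat.cast_sub (by omega), Nat.cast_sub (by omega)]
    rw [abs_sub_comm] at h
    convert h using 2
    push_cast
    ring
  K_irred i h := by
    obtain ⟨h1, h2⟩ := c.K_irred (n - 1 - i) (by omega)
    have e1 : (Fin.rev ⟨i, by omega⟩ : Fin (n + 1)) = ⟨n - 1 - i + 1, by omega⟩ := by
      ext; simp only [Fin.val_rev]; omega
    have e2 : (Fin.rev ⟨i + 1, by omega⟩ : Fin (n + 1)) = ⟨n - 1 - i, by omega⟩ := by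
      ext; simp only [Fin.val_rev]; omega
    simp only [Matrix.of_apply, e1, e2]
    exact ⟨h2, h1⟩
  pi_pos i := c.pi_pos _
  pi_sum := by
    rw [← c.pi_sum]
    exact Equiv.sum_comp Fin.revPerm c.pi
  pi_stat j := by
    simp only [Matrix.of_apply]
    rw [← c.pi_stat j.rev]
    exact Equiv.sum_comp Fin.revPerm fun i => c.pi i * c.K i j.rev

variable (c : BDChain n)

@[simp] lemma rev_pi (i : Fin (n + 1)) : c.rev.pi i = c.pi i.rev := rfl

@[simp] lemma rev_K (i j : Fin (n + 1)) : c.rev.K i j = c.K i.rev j.rev := rfl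

lemma K_eq_zero {x y : Fin (n + 1)} (h : (x : ℕ) + 1 < y ∨ (y : ℕ) + 1 < x) : c.K x y = 0 := by
  apply c.K_tridiag
  rcases h with h | h
  · rw [abs_sub_comm, lt_abs]; left; omega
  · rw [lt_abs]; left; omega

lemma edgeWt_eq {x y : Fin (n + 1)} (h : (y : ℕ) = x + 1) : c.edgeWt x = c.pi x * c.K x y := by
  have hx : (x : ℕ) < n := by omega
  rw [edgeWt, dif_pos hx]
  congr 2
  ext; simp [h]

lemma sum_cut (J : Fin (n + 1) → Fin (n + 1) → ℝ) (hJ : ∀ i j, J i j = -J j i)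
    (hJ' : ∀ i, ∑ j, J i j = 0) (k : ℕ) :
    ∑ i : Fin (n + 1), ∑ j : Fin (n + 1), (if (i : ℕ) ≤ k ∧ k < (j : ℕ) then J i j else 0) = 0 := by
  have h1 : ∑ i : Fin (n + 1), ∑ j : Fin (n + 1),
      (if (i : ℕ) ≤ k ∧ (j : ℕ) ≤ k then J i j else 0) = 0 := by
    have : ∑ i : Fin (n + 1), ∑ j : Fin (n + 1), (if (i : ℕ) ≤ k ∧ (j : ℕ) ≤ k then J i j else 0) =
        -∑ i : Fin (n + 1), ∑ j : Fin (n + 1),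
            (if (i : ℕ) ≤ k ∧ (j : ℕ) ≤ k then J i j else 0) := by
      conv_lhs => rw [Finset.sum_comm]
      rw [← Finset.sum_neg_distrib]
      refine Finset.sum_congr rfl fun i _ => ?_
      rw [← Finset.sum_neg_distrib]
      refine Finset.sum_congr rfl fun j _ => ?_
      rw [hJ j i]
      by_cases h : (i : ℕ) ≤ k <;> by_cases h' : (j : ℕ) ≤ k <;> simp [h, h']
    linarith
  have h2 : ∑ i : Fin (n + 1), ∑ j : Fin (n + 1), (if (i : ℕ) ≤ k then J i j else 0) = 0 := by
    refine Finset.sum_eq_zero fun i _ => ?_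
    by_cases h : (i : ℕ) ≤ k <;> simp [h, hJ']
  have h3 : ∑ i : Fin (n + 1), ∑ j : Fin (n + 1), (if (i : ℕ) ≤ k then J i j else 0) =
      ∑ i : Fin (n + 1), ∑ j : Fin (n + 1), (if (i : ℕ) ≤ k ∧ k < (j : ℕ) then J i j else 0) +
      ∑ i : Fin (n + 1), ∑ j : Fin (n + 1), (if (i : ℕ) ≤ k ∧ (j : ℕ) ≤ k then J i j else 0) := by
    rw [← Finset.sum_add_distrib]
    refine Finset.sum_congr rfl fun i _ => ?_
    rw [← Finset.sum_add_distrib]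
    refine Finset.sum_congr rfl fun j _ => ?_
    by_cases h : (i : ℕ) ≤ k <;> by_cases h' : k < (j : ℕ) <;> simp [h, h', not_le.2, not_lt.1]
  rw [h1, h2, add_zero] at h3
  exact h3.symm

lemma detailed_balance {x y : Fin (n + 1)} (h : (y : ℕ) = x + 1) :
    c.pi x * c.K x y = c.pi y * c.K y x := by
  have key := sum_cut (fun i j => c.pi i * c.K i j - c.pi j * c.K j i) (fun i j => by ring)
    (fun i => by
      rw [Finset.sum_sub_distrib, ← Finset.mul_sum, c.K_rowSum, c.pi_stat]; ring) x
  rw [Finset.sum_eq_single x, Finset.sum_eq_single y] at key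
  · rw [if_pos ⟨le_rfl, by omega⟩] at key
    linarith
  · intro j _ hj
    by_cases h' : (x : ℕ) < j
    · have : (j : ℕ) ≠ y := fun e => hj (Fin.ext e)
      rw [c.K_eq_zero (x := x) (y := j) (by omega), c.K_eq_zero (x := j) (y := x) (by omega)]
      simp
    · simp [h']
  · simp
  · intro i _ hi
    refine Finset.sum_eq_zero fun j _ => ?_
    have : (i : ℕ) ≠ x := fun e => hi (Fin.ext e)
    by_cases h' : (i : ℕ) ≤ x ∧ (x : ℕ) < j
    · rw [c.K_eq_zero (x := i) (y := j) (by omega), c.K_eq_zero (x := j) (y := i) (by omega)]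
      simp
    · exact if_neg h'
  · simp

lemma edgeWt_eq' {x y : Fin (n + 1)} (h : (y : ℕ) = x + 1) : c.edgeWt x = c.pi y * c.K y x := by
  rw [c.edgeWt_eq h, c.detailed_balance h]

lemma edgeWt_pos {k : ℕ} (h : k < n) : 0 < c.edgeWt k := by
  rw [edgeWt, dif_pos h]
  exact mul_pos (c.pi_pos _) (c.K_irred k h).1

lemma edgeWt_of_le {k : ℕ} (h : n ≤ k) : c.edgeWt k = 0 := by
  rw [edgeWt, dif_neg (by omega)]

lemma edgeWt_nonneg (k : ℕ) : 0 ≤ c.edgeWt k := by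
  rcases lt_or_ge k n with h | h
  · exact (c.edgeWt_pos h).le
  · rw [c.edgeWt_of_le h]

lemma rev_edgeWt {k : ℕ} (h : k < n) : c.rev.edgeWt (n - 1 - k) = c.edgeWt k := by
  have e1 : (Fin.rev ⟨n - 1 - k, by omega⟩ : Fin (n + 1)) = ⟨k + 1, by omega⟩ := by
    ext; simp only [Fin.val_rev]; omega
  have e2 : (Fin.rev ⟨n - 1 - k + 1, by omega⟩ : Fin (n + 1)) = ⟨k, by omega⟩ := by
    ext; simp only [Fin.val_rev]; omega
  rw [c.edgeWt_eq' (x := ⟨k, by omega⟩) (y := ⟨k + 1, by omega⟩) rfl, edgeWt,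
    dif_pos (by omega : n - 1 - k < n)]
  simp only [rev_pi, rev_K, e1, e2]

lemma pi_mul_K_sub (F : ℕ → ℝ) (x y : Fin (n + 1)) :
    c.pi x * (c.K x y * (F y - F x)) =
      (if (y : ℕ) = x + 1 then c.edgeWt x * (F (x + 1) - F x) else 0) +
      (if (y : ℕ) + 1 = x then c.prevWt x * (F (x - 1) - F x) else 0) := by
  rcases lt_trichotomy (y : ℕ) x with h | h | h
  · rw [if_neg (by omega), zero_add]
    split_ifs with h'
    · have h1 : c.prevWt x = c.edgeWt y := by rw [← h']; rfl
      rw [h1, c.edgeWt_eq' h'.symm, ← h', Nat.add_sub_cancel]; ring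
    · rw [c.K_eq_zero (by omega)]; ring
  · rw [if_neg (by omega), if_neg (by omega), h]; ring
  · rw [if_neg (by omega : ¬ (y : ℕ) + 1 = x), add_zero]
    split_ifs with h'
    · rw [c.edgeWt_eq h', h']; ring
    · rw [c.K_eq_zero (by omega)]; ring

lemma generator (F : ℕ → ℝ) (x : Fin (n + 1)) :
    c.pi x * ∑ y, c.K x y * (F y - F x) =
      c.edgeWt x * (F (x + 1) - F x) + c.prevWt x * (F (x - 1) - F x) := by
  rw [Finset.mul_sum, Finset.sum_congr rfl fun y _ => c.pi_mul_K_sub F x y,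
    Finset.sum_add_distrib]
  congr 1
  · by_cases h : (x : ℕ) < n
    · rw [Finset.sum_eq_single ⟨x + 1, by omega⟩]
      · simp
      · intro y _ hy
        exact if_neg fun e => hy (Fin.ext e)
      · simp
    · rw [c.edgeWt_of_le (by omega)]; simp
  · obtain ⟨x, hx⟩ := x
    cases x with
    | zero => simp
    | succ k =>
      rw [Finset.sum_eq_single ⟨k, by omega⟩]
      · simp
      · intro y _ hy
        exact if_neg fun e => hy (Fin.ext (Nat.succ_injective e))
      · simp

lemma sum_K_mul (F : ℕ → ℝ) (x : Fin (n + 1)) :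
    ∑ y, c.K x y * F y = F x + ∑ y, c.K x y * (F y - F x) := by
  simp only [mul_sub, Finset.sum_sub_distrib, ← Finset.sum_mul, c.K_rowSum]
  ring

/-- A function with prescribed generator values satisfies the corresponding mean value identity. -/
lemma sum_K_mul_of_generator {F : ℕ → ℝ} {x : Fin (n + 1)} {d : ℝ}
    (h : c.edgeWt x * (F (x + 1) - F x) + c.prevWt x * (F (x - 1) - F x) = c.pi x * d) :
    ∑ y, c.K x y * F y = F x + d := by
  rw [c.sum_K_mul, mul_left_cancel₀ (c.pi_pos x).ne' ((c.generator F x).trans h)]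

lemma edgeWt_add_prevWt (x : Fin (n + 1)) :
    c.edgeWt x + c.prevWt x = c.pi x * (1 - c.K x x) := by
  have h1 : ∑ y, c.K x y * ((if (y : ℕ) = x then (0 : ℝ) else 1) - 0) = 1 - c.K x x := by
    have h2 : ∀ y, c.K x y * ((if (y : ℕ) = x then (0 : ℝ) else 1) - 0) =
        c.K x y - if x = y then c.K x y else 0 := fun y => by
      by_cases e : x = y
      · simp [e]
      · simp [e, Fin.val_inj, Ne.symm e]
    rw [Finset.sum_congr rfl fun y _ => h2 y, Finset.sum_sub_distrib, c.K_rowSum,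
      Finset.sum_ite_eq, if_pos (Finset.mem_univ x)]
  have h := c.generator (fun k => if k = (x : ℕ) then 0 else 1) x
  simp only [if_true] at h
  rw [← h1, h]
  obtain ⟨x, hx⟩ := x
  cases x with
  | zero => simp [prevWt]
  | succ k => simp

lemma cum_zero : c.cum 0 = c.pi 0 := by
  rw [cum, Finset.sum_eq_single 0]
  · simp
  · intro y _ hy
    exact if_neg fun e => hy (Fin.ext (by simpa using e))
  · simp

lemma cum_succ {k : ℕ} (h : k + 1 < n + 1) : c.cum (k + 1) = c.cum k + c.pi ⟨k + 1, h⟩ := by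
  have : c.pi ⟨k + 1, h⟩ = ∑ x : Fin (n + 1), if (x : ℕ) = k + 1 then c.pi x else 0 := by
    rw [Finset.sum_eq_single ⟨k + 1, h⟩]
    · simp
    · intro y _ hy
      exact if_neg fun e => hy (Fin.ext e)
    · simp
  rw [this, cum, cum, ← Finset.sum_add_distrib]
  refine Finset.sum_congr rfl fun x _ => ?_
  by_cases h1 : (x : ℕ) ≤ k
  · rw [if_pos (by omega), if_pos h1, if_neg (by omega), add_zero]
  · by_cases h2 : (x : ℕ) = k + 1
    · rw [if_pos (by omega), if_neg h1, if_pos h2, zero_add]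
    · rw [if_neg (by omega), if_neg h1, if_neg h2, zero_add]

lemma cum_mono : Monotone c.cum := by
  intro a b h
  refine Finset.sum_le_sum fun x _ => ?_
  split_ifs
  · exact le_rfl
  · omega
  · exact (c.pi_pos x).le
  · exact le_rfl

lemma pi_le_cum (x : Fin (n + 1)) : c.pi x ≤ c.cum x := by
  have := Finset.single_le_sum (f := fun y : Fin (n + 1) => if (y : ℕ) ≤ x then c.pi y else 0)
    (fun y _ => by split_ifs; exacts [(c.pi_pos y).le, le_rfl]) (Finset.mem_univ x)
  rwa [if_pos le_rfl] at this

lemma cum_pos (k : ℕ) : 0 < c.cum k :=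
  (c.cum_zero ▸ c.pi_pos 0).trans_le (c.cum_mono (Nat.zero_le k))

lemma cum_le_one (k : ℕ) : c.cum k ≤ 1 := by
  rw [← c.pi_sum]
  refine Finset.sum_le_sum fun x _ => ?_
  split_ifs
  exacts [le_rfl, (c.pi_pos x).le]

end BDChain

namespace BDChain

variable {n : ℕ}

/-- The kernel killed upon leaving `[0, i-1]`. -/
def upK (c : BDChain n) (i : ℕ) : Matrix (Fin (n + 1)) (Fin (n + 1)) ℝ :=
  Matrix.of fun x y => if (x : ℕ) < i then c.K x y else 0

/-- The probability, starting from `x`, that the chain stays in `[0, i-1]` at times `0, ..., m`. -/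
def upSurv (c : BDChain n) (i m : ℕ) : Fin (n + 1) → ℝ :=
  c.upK i ^ m *ᵥ fun x => if (x : ℕ) < i then 1 else 0

/-- Expected crossing time from `k` to `k + 1`. -/
def stepMean (c : BDChain n) (k : ℕ) : ℝ := c.cum k / c.edgeWt k

/-- Expected hitting time of `i` from `x ≤ i`. -/
def upMean (c : BDChain n) (i x : ℕ) : ℝ := ∑ k ∈ Finset.Ico x i, c.stepMean k

/-- `π([0,k])² / (π(k) p_k)`. -/
def cumSqDiv (c : BDChain n) (k : ℕ) : ℝ := c.cum k ^ 2 / c.edgeWt k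

/-- The value of `cumSqDiv` at the preceding state (zero at `0`). -/
def prevCumSqDiv (c : BDChain n) : ℕ → ℝ
  | 0 => 0
  | k + 1 => c.cumSqDiv k

/-- Variance of the crossing time from `k` to `k + 1`. -/
def stepVar (c : BDChain n) (k : ℕ) : ℝ :=
  (∑ l ∈ Finset.range (k + 1), (c.cumSqDiv l + c.prevCumSqDiv l) - c.cum k) / c.edgeWt k

/-- Variance of the hitting time of `i` from `x ≤ i`. -/
def upVar (c : BDChain n) (i x : ℕ) : ℝ := ∑ k ∈ Finset.Ico x i, c.stepVar k

variable (c : BDChain n)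

lemma upK_mulVec (i : ℕ) (g : Fin (n + 1) → ℝ) (x : Fin (n + 1)) :
    (c.upK i *ᵥ g) x = if (x : ℕ) < i then ∑ y, c.K x y * g y else 0 := by
  simp only [upK, Matrix.mulVec, dotProduct, Matrix.of_apply]
  split_ifs <;> simp

lemma upK_mulVec_mono (i : ℕ) {g g' : Fin (n + 1) → ℝ} (h : g ≤ g') :
    c.upK i *ᵥ g ≤ c.upK i *ᵥ g' := by
  intro x
  rw [upK_mulVec, upK_mulVec]
  split_ifs
  · exact Finset.sum_le_sum fun y _ => mul_le_mul_of_nonneg_left (h y) (c.K_nonneg x y)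
  · exact le_rfl

lemma pow_succ_mulVec {ι : Type*} [Fintype ι] [DecidableEq ι] (A : Matrix ι ι ℝ) (m : ℕ)
    (g : ι → ℝ) : A ^ (m + 1) *ᵥ g = A *ᵥ (A ^ m *ᵥ g) := by
  rw [pow_succ', Matrix.mulVec_mulVec]

lemma upK_pow_mulVec_mono (i m : ℕ) {g g' : Fin (n + 1) → ℝ} (h : g ≤ g') :
    c.upK i ^ m *ᵥ g ≤ c.upK i ^ m *ᵥ g' := by
  induction m with
  | zero => simpa using h
  | succ m ih =>
    rw [pow_succ_mulVec, pow_succ_mulVec]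
    exact c.upK_mulVec_mono i ih

lemma upSurv_zero (i : ℕ) (x : Fin (n + 1)) :
    c.upSurv i 0 x = if (x : ℕ) < i then 1 else 0 := by
  simp [upSurv]

lemma upSurv_succ (i m : ℕ) (x : Fin (n + 1)) :
    c.upSurv i (m + 1) x = if (x : ℕ) < i then ∑ y, c.K x y * c.upSurv i m y else 0 := by
  rw [upSurv, pow_succ_mulVec, upK_mulVec]
  rfl

lemma upSurv_of_le {i : ℕ} (m : ℕ) {x : Fin (n + 1)} (h : i ≤ x) : c.upSurv i m x = 0 := by
  cases m with
  | zero => rw [upSurv_zero, if_neg (by omega)]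
  | succ m => rw [upSurv_succ, if_neg (by omega)]

lemma upSurv_nonneg (i m : ℕ) (x : Fin (n + 1)) : 0 ≤ c.upSurv i m x := by
  induction m generalizing x with
  | zero => rw [upSurv_zero]; split_ifs <;> norm_num
  | succ m ih =>
    rw [upSurv_succ]
    split_ifs
    · exact Finset.sum_nonneg fun y _ => mul_nonneg (c.K_nonneg x y) (ih y)
    · exact le_rfl

/-- Averages of a function bounded by `b` are bounded by `b`. -/
lemma sum_K_mul_le (x : Fin (n + 1)) {g : Fin (n + 1) → ℝ} {b : ℝ} (h : ∀ y, g y ≤ b) :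
    ∑ y, c.K x y * g y ≤ b := by
  calc ∑ y, c.K x y * g y ≤ ∑ y, c.K x y * b :=
        Finset.sum_le_sum fun y _ => mul_le_mul_of_nonneg_left (h y) (c.K_nonneg x y)
    _ = b := by rw [← Finset.sum_mul, c.K_rowSum, one_mul]

lemma sum_K_mul_add (x : Fin (n + 1)) (g : Fin (n + 1) → ℝ) (b : ℝ) :
    ∑ y, c.K x y * (g y + b) = ∑ y, c.K x y * g y + b := by
  simp only [mul_add, Finset.sum_add_distrib, ← Finset.sum_mul, c.K_rowSum, one_mul]

lemma upSurv_le_one (i m : ℕ) (x : Fin (n + 1)) : c.upSurv i m x ≤ 1 := by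
  induction m generalizing x with
  | zero => rw [upSurv_zero]; split_ifs <;> norm_num
  | succ m ih =>
    rw [upSurv_succ]
    split_ifs
    · exact c.sum_K_mul_le x ih
    · exact zero_le_one

lemma upSurv_succ_le (i m : ℕ) (x : Fin (n + 1)) : c.upSurv i (m + 1) x ≤ c.upSurv i m x := by
  induction m generalizing x with
  | zero =>
    by_cases h : (x : ℕ) < i
    · rw [c.upSurv_zero, if_pos h]; exact c.upSurv_le_one _ _ _
    · rw [c.upSurv_of_le _ (not_lt.1 h), c.upSurv_of_le _ (not_lt.1 h)]
  | succ m ih =>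
    rw [upSurv_succ _ _ (m + 1), upSurv_succ _ _ m]
    split_ifs
    · exact Finset.sum_le_sum fun y _ => mul_le_mul_of_nonneg_left (ih y) (c.K_nonneg x y)
    · exact le_rfl

lemma upSurv_anti (i : ℕ) (x : Fin (n + 1)) : Antitone fun m => c.upSurv i m x :=
  antitone_nat_of_succ_le fun m => c.upSurv_succ_le i m x

lemma edgeWt_mul_stepMean {k : ℕ} (h : k < n) : c.edgeWt k * c.stepMean k = c.cum k :=
  mul_div_cancel₀ _ (c.edgeWt_pos h).ne'

lemma edgeWt_mul_stepMean_sq {k : ℕ} (h : k < n) :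
    c.edgeWt k * c.stepMean k ^ 2 = c.cumSqDiv k := by
  have := (c.edgeWt_pos h).ne'
  rw [stepMean, cumSqDiv]
  field_simp

lemma edgeWt_mul_stepVar {k : ℕ} (h : k < n) :
    c.edgeWt k * c.stepVar k =
      ∑ l ∈ Finset.range (k + 1), (c.cumSqDiv l + c.prevCumSqDiv l) - c.cum k :=
  mul_div_cancel₀ _ (c.edgeWt_pos h).ne'

lemma sum_Ico_eq_add (f : ℕ → ℝ) {x i : ℕ} (h : x < i) :
    ∑ k ∈ Finset.Ico x i, f k = f x + ∑ k ∈ Finset.Ico (x + 1) i, f k :=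
  Finset.sum_eq_sum_Ico_succ_bot h f

lemma sum_K_mul_upMean {i : ℕ} (hi : i ≤ n) {x : Fin (n + 1)} (hx : (x : ℕ) < i) :
    ∑ y, c.K x y * c.upMean i y = c.upMean i x - 1 := by
  rw [sub_eq_add_neg]
  apply c.sum_K_mul_of_generator
  have e := c.edgeWt_mul_stepMean (hx.trans_le hi)
  have h1 : c.upMean i x = c.stepMean x + c.upMean i (x + 1) := sum_Ico_eq_add _ hx
  obtain ⟨x, hxn⟩ := x
  cases x with
  | zero =>
    simp only [prevWt, zero_mul, add_zero] at *
    rw [c.cum_zero] at e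
    change _ = c.pi 0 * _
    linear_combination (-c.edgeWt 0) * h1 - e
  | succ k =>
    simp only [prevWt, Nat.add_sub_cancel] at *
    have h2 : c.upMean i k = c.stepMean k + c.upMean i (k + 1) := sum_Ico_eq_add _ (by omega)
    have e2 := c.edgeWt_mul_stepMean (k := k) (by omega)
    have e3 := c.cum_succ hxn
    linear_combination (-c.edgeWt (k + 1)) * h1 + c.edgeWt k * h2 - e + e2 - e3

lemma sum_K_mul_upVar {i : ℕ} (hi : i ≤ n) {x : Fin (n + 1)} (hx : (x : ℕ) < i) (t : ℝ) :
    ∑ y, c.K x y * (c.upVar i y + (c.upMean i y + (t + 1)) ^ 2) =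
      c.upVar i x + (c.upMean i x + t) ^ 2 := by
  have key := c.sum_K_mul_of_generator (F := fun y => c.upVar i y + (c.upMean i y + (t + 1)) ^ 2)
    (x := x) (d := -(2 * (c.upMean i x + t) + 1)) ?_
  · rw [key]; ring
  have e := c.edgeWt_mul_stepMean (hx.trans_le hi)
  have e' := c.edgeWt_mul_stepMean_sq (hx.trans_le hi)
  have e'' := c.edgeWt_mul_stepVar (hx.trans_le hi)
  have h1 : c.upMean i x = c.stepMean x + c.upMean i (x + 1) := sum_Ico_eq_add _ hx
  have h1' : c.upVar i x = c.stepVar x + c.upVar i (x + 1) := sum_Ico_eq_add _ hx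
  obtain ⟨x, hxn⟩ := x
  cases x with
  | zero =>
    simp only [prevWt, prevCumSqDiv, zero_mul, add_zero, zero_add, Finset.sum_range_one] at *
    rw [c.cum_zero] at e e''
    change _ = c.pi 0 * _
    rw [h1', h1]
    linear_combination (-2 * (c.upMean i 1 + t + 1) - 2 * c.stepMean 0) * e + e' - e''
  | succ k =>
    simp only [prevWt, Nat.add_sub_cancel] at *
    have h2 : c.upMean i k = c.stepMean k + c.upMean i (k + 1) := sum_Ico_eq_add _ (by omega)
    have h2' : c.upVar i k = c.stepVar k + c.upVar i (k + 1) := sum_Ico_eq_add _ (by omega)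
    have f := c.edgeWt_mul_stepMean (k := k) (by omega)
    have f' := c.edgeWt_mul_stepMean_sq (k := k) (by omega)
    have f'' := c.edgeWt_mul_stepVar (k := k) (by omega)
    have e3 := c.cum_succ hxn
    rw [Finset.sum_range_succ, prevCumSqDiv] at e''
    rw [h2', h2, eq_sub_of_add_eq' h1.symm, eq_sub_of_add_eq' h1'.symm]
    linear_combination (-2 * (c.upMean i (k + 1) + t + 1)) * e + e' - e'' +
      2 * (c.upMean i (k + 1) + t + 1) * f + f' + f'' -
      (2 * (c.upMean i (k + 1) + t + 1) - 1) * e3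

/-- Chebyshev's inequality, upper tail. -/
lemma upSurv_mul_sq_le {i : ℕ} (hi : i ≤ n) (m : ℕ) (x : Fin (n + 1)) (hx : (x : ℕ) ≤ i)
    (hv : ∀ k, k ≤ i → 0 ≤ c.upVar i k) (hm : ∀ k, k ≤ i → 0 ≤ c.upMean i k)
    (t : ℝ) (ht : 0 ≤ m + t) :
    c.upSurv i m x * (m + t) ^ 2 ≤ c.upVar i x + (c.upMean i x + t) ^ 2 := by
  induction m generalizing x t with
  | zero =>
    have h0 : (0 : ℝ) ≤ c.upVar i x := hv x hx
    have h1 : (0 : ℝ) ≤ c.upMean i x := hm x hx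
    rw [upSurv_zero]
    push_cast at ht ⊢
    split_ifs
    · nlinarith
    · nlinarith [sq_nonneg (c.upMean i x + t)]
  | succ m ih =>
    rcases lt_or_ge (x : ℕ) i with h | h
    · rw [upSurv_succ, if_pos h, ← c.sum_K_mul_upVar hi h, Finset.sum_mul]
      refine Finset.sum_le_sum fun y _ => ?_
      rcases le_or_gt (y : ℕ) i with hy | hy
      · rw [mul_assoc]
        refine mul_le_mul_of_nonneg_left ?_ (c.K_nonneg x y)
        have := ih y hy (t + 1) (by push_cast at ht; linarith)
        rwa [show ((m : ℝ) + (t + 1)) = (m + 1 : ℕ) + t by push_cast; ring] at this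
      · rw [c.K_eq_zero (by omega)]; simp
    · rw [c.upSurv_of_le _ h, zero_mul]
      have h0 : (0 : ℝ) ≤ c.upVar i x := hv x hx
      positivity

/-- Chebyshev's inequality, lower tail. -/
lemma one_sub_upSurv_mul_sq_le {i : ℕ} (hi : i ≤ n) (m : ℕ) (x : Fin (n + 1)) (hx : (x : ℕ) ≤ i)
    (hv : ∀ k, k ≤ i → 0 ≤ c.upVar i k)
    (t : ℝ) (ht : m + t ≤ 0) :
    (1 - c.upSurv i m x) * (m + t) ^ 2 ≤ c.upVar i x + (c.upMean i x + t) ^ 2 := by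
  have h0 : (0 : ℝ) ≤ c.upVar i x := hv x hx
  induction m generalizing x t with
  | zero =>
    rcases lt_or_ge (x : ℕ) i with h | h
    · rw [upSurv_zero, if_pos h, sub_self, zero_mul]; positivity
    · have e : c.upMean i x = 0 := by rw [upMean, Finset.Ico_eq_empty (by omega)]; rfl
      rw [c.upSurv_of_le _ h, e]
      push_cast
      linarith
  | succ m ih =>
    rcases lt_or_ge (x : ℕ) i with h | h
    · have e : 1 - c.upSurv i (m + 1) x = ∑ y, c.K x y * (1 - c.upSurv i m y) := by
        rw [upSurv_succ, if_pos h]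
        simp only [mul_sub, Finset.sum_sub_distrib, mul_one, c.K_rowSum]
      rw [e, ← c.sum_K_mul_upVar hi h, Finset.sum_mul]
      refine Finset.sum_le_sum fun y _ => ?_
      rcases le_or_gt (y : ℕ) i with hy | hy
      · rw [mul_assoc]
        refine mul_le_mul_of_nonneg_left ?_ (c.K_nonneg x y)
        have := ih y hy (t + 1) (by push_cast at ht; linarith) (hv y hy)
        rwa [show ((m : ℝ) + (t + 1)) = (m + 1 : ℕ) + t by push_cast; ring] at this
      · rw [c.K_eq_zero (by omega)]; simp
    · have e : c.upMean i x = 0 := by rw [upMean, Finset.Ico_eq_empty (by omega)]; rfl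
      rw [c.upSurv_of_le _ h, e]
      push_cast at ht ⊢
      have : (0 : ℝ) ≤ m := m.cast_nonneg
      nlinarith

/-- Markov's inequality. -/
lemma upSurv_mul_le {i : ℕ} (hi : i ≤ n) (m : ℕ) (x : Fin (n + 1)) (hx : (x : ℕ) ≤ i)
    (hm : ∀ k, k ≤ i → 0 ≤ c.upMean i k) (t : ℝ) (ht : 0 ≤ t) :
    c.upSurv i m x * (m + t) ≤ c.upMean i x + t := by
  have h1 : (0 : ℝ) ≤ c.upMean i x := hm x hx
  induction m generalizing x t with
  | zero =>
    rw [upSurv_zero]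
    push_cast
    split_ifs <;> linarith
  | succ m ih =>
    rcases lt_or_ge (x : ℕ) i with h | h
    · have e : c.upMean i x + t = ∑ y, c.K x y * (c.upMean i y + (t + 1)) := by
        rw [c.sum_K_mul_add, c.sum_K_mul_upMean hi h]; ring
      rw [upSurv_succ, if_pos h, e, Finset.sum_mul]
      refine Finset.sum_le_sum fun y _ => ?_
      rcases le_or_gt (y : ℕ) i with hy | hy
      · rw [mul_assoc]
        refine mul_le_mul_of_nonneg_left ?_ (c.K_nonneg x y)
        have := ih y hy (t + 1) (by linarith) (hm y hy)
        rwa [show ((m : ℝ) + (t + 1)) = (m + 1 : ℕ) + t by push_cast; ring] at this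
      · rw [c.K_eq_zero (by omega)]; simp
    · rw [c.upSurv_of_le _ h, zero_mul]; linarith

end BDChain

namespace BDChain

variable {n : ℕ} (c : BDChain n)

lemma stepMean_nonneg (k : ℕ) : 0 ≤ c.stepMean k :=
  div_nonneg (c.cum_pos k).le (c.edgeWt_nonneg k)

lemma upMean_nonneg (i x : ℕ) : 0 ≤ c.upMean i x :=
  Finset.sum_nonneg fun k _ => c.stepMean_nonneg k

lemma cumSqDiv_nonneg (k : ℕ) : 0 ≤ c.cumSqDiv k :=
  div_nonneg (sq_nonneg _) (c.edgeWt_nonneg k)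

lemma prevCumSqDiv_nonneg (k : ℕ) : 0 ≤ c.prevCumSqDiv k := by
  cases k with
  | zero => exact le_rfl
  | succ k => exact c.cumSqDiv_nonneg k

lemma pi_le_cumSqDiv (x : Fin (n + 1)) (hx : (x : ℕ) < n) :
    c.pi x ≤ (1 - c.K x x) * (c.cumSqDiv x + c.prevCumSqDiv x) := by
  have e := c.edgeWt_mul_stepMean hx
  have e' := c.edgeWt_mul_stepMean_sq hx
  have hw := c.edgeWt_add_prevWt x
  have hp := c.pi_pos x
  have h0 := c.edgeWt_nonneg x
  have key : c.pi x ^ 2 ≤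
      (c.edgeWt x + c.prevWt x) * (c.cumSqDiv x + c.prevCumSqDiv x) := by
    obtain ⟨x, hxn⟩ := x
    cases x with
    | zero =>
      simp only [prevWt, prevCumSqDiv, add_zero] at *
      rw [c.cum_zero] at e
      change c.pi 0 ^ 2 ≤ _
      rw [← e, ← e']
      exact le_of_eq (by ring)
    | succ k =>
      simp only [prevWt, prevCumSqDiv] at *
      have f := c.edgeWt_mul_stepMean (k := k) (by omega)
      have f' := c.edgeWt_mul_stepMean_sq (k := k) (by omega)
      have h1 := c.edgeWt_nonneg k
      have e3 : c.pi ⟨k + 1, hxn⟩ = c.edgeWt (k + 1) * c.stepMean (k + 1) -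
          c.edgeWt k * c.stepMean k := by rw [e, f, c.cum_succ hxn]; ring
      rw [e3, ← e', ← f']
      nlinarith [mul_nonneg (mul_nonneg h0 h1)
        (sq_nonneg (c.stepMean (k + 1) + c.stepMean k))]
  rw [hw] at key
  refine le_of_mul_le_mul_left ?_ hp
  linarith

variable {δ : ℝ}

lemma cum_le_sum (hδ : ∀ x, δ ≤ c.K x x) {k : ℕ} (hk : k < n) :
    c.cum k ≤ (1 - δ) * ∑ l ∈ Finset.range (k + 1), (c.cumSqDiv l + c.prevCumSqDiv l) := by
  have key (x : Fin (n + 1)) (hx : (x : ℕ) < n) :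
      c.pi x ≤ (1 - δ) * (c.cumSqDiv x + c.prevCumSqDiv x) :=
    (c.pi_le_cumSqDiv x hx).trans <| mul_le_mul_of_nonneg_right (by linarith [hδ x])
      (add_nonneg (c.cumSqDiv_nonneg x) (c.prevCumSqDiv_nonneg x))
  induction k with
  | zero =>
    rw [c.cum_zero, Finset.sum_range_one]
    exact key 0 hk
  | succ k ih =>
    rw [c.cum_succ (by omega), Finset.sum_range_succ, mul_add]
    exact add_le_add (ih (by omega)) (key ⟨k + 1, by omega⟩ hk)

lemma mul_div_le_stepVar (hδ0 : 0 ≤ δ) (hδ : ∀ x, δ ≤ c.K x x) {k : ℕ} (hk : k < n) :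
    δ * (∑ l ∈ Finset.range (k + 1), c.cumSqDiv l) / c.edgeWt k ≤ c.stepVar k := by
  refine div_le_div_of_nonneg_right ?_ (c.edgeWt_nonneg k)
  have h1 := c.cum_le_sum hδ hk
  have h2 : ∑ l ∈ Finset.range (k + 1), c.cumSqDiv l ≤
      ∑ l ∈ Finset.range (k + 1), (c.cumSqDiv l + c.prevCumSqDiv l) :=
    Finset.sum_le_sum fun l _ => le_add_of_nonneg_right (c.prevCumSqDiv_nonneg l)
  nlinarith

lemma stepVar_nonneg (k : ℕ) : 0 ≤ c.stepVar k := by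
  rcases lt_or_ge k n with h | h
  · refine le_trans ?_ (c.mul_div_le_stepVar le_rfl (fun x => c.K_nonneg x x) h)
    simp
  · rw [stepVar, c.edgeWt_of_le h, div_zero]

lemma upVar_nonneg (i x : ℕ) : 0 ≤ c.upVar i x :=
  Finset.sum_nonneg fun k _ => c.stepVar_nonneg k

lemma stepVar_le (k : ℕ) :
    c.stepVar k ≤ 2 * (∑ l ∈ Finset.range (k + 1), c.cumSqDiv l) / c.edgeWt k := by
  refine div_le_div_of_nonneg_right ?_ (c.edgeWt_nonneg k)
  have h : ∑ l ∈ Finset.range (k + 1), c.prevCumSqDiv l ≤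
      ∑ l ∈ Finset.range (k + 1), c.cumSqDiv l := by
    rw [Finset.sum_range_succ']
    simp only [prevCumSqDiv, add_zero]
    exact Finset.sum_le_sum_of_subset_of_nonneg (Finset.range_subset_range.2 (by omega))
      fun l _ _ => c.cumSqDiv_nonneg l
  rw [Finset.sum_add_distrib]
  linarith [c.cum_pos k]

lemma hitSurv_succ (i j : Fin (n + 1)) (m : ℕ) :
    c.hitSurv i j (m + 1) = if j = i then 0 else ∑ y, c.K j y * c.hitSurv i y m := by
  have e (j : Fin (n + 1)) (m : ℕ) :
      ∑ y, (c.killed i ^ m) j y = (c.killed i ^ m *ᵥ fun _ => 1) j := by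
    simp [Matrix.mulVec, dotProduct]
  unfold hitSurv
  split_ifs with h
  · rfl
  · rw [e, pow_succ_mulVec]
    simp only [e]
    rw [Matrix.mulVec, dotProduct]
    refine Finset.sum_congr rfl fun y _ => ?_
    simp only [killed, Matrix.of_apply, h, false_or]
    split_ifs <;> simp

lemma hitSurv_zero (i j : Fin (n + 1)) : c.hitSurv i j 0 = if j = i then 0 else 1 := by
  simp [hitSurv, Matrix.one_apply]

lemma hitSurv_eq_upSurv (i j : Fin (n + 1)) (h : j ≤ i) (m : ℕ) :
    c.hitSurv i j m = c.upSurv i m j := by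
  induction m generalizing j with
  | zero =>
    rw [hitSurv_zero, upSurv_zero]
    rcases h.lt_or_eq with h' | h'
    · rw [if_neg h'.ne, if_pos (Fin.lt_def.1 h')]
    · rw [if_pos h', if_neg (by simp [h'])]
  | succ m ih =>
    rw [hitSurv_succ, upSurv_succ]
    rcases h.lt_or_eq with h' | h'
    · rw [if_neg h'.ne, if_pos (Fin.lt_def.1 h')]
      refine Finset.sum_congr rfl fun y _ => ?_
      rcases le_or_gt y i with hy | hy
      · rw [ih y hy]
      · rw [c.K_eq_zero (by have := Fin.lt_def.1 h'; have := Fin.lt_def.1 hy; omega)]; simp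
    · rw [if_pos h', if_neg (by simp [h'])]

lemma rev_hitSurv (i j : Fin (n + 1)) (m : ℕ) :
    c.rev.hitSurv i.rev j.rev m = c.hitSurv i j m := by
  induction m generalizing j with
  | zero => simp [hitSurv_zero]
  | succ m ih =>
    rw [hitSurv_succ, hitSurv_succ]
    simp only [Fin.rev_inj, rev_K, Fin.rev_rev]
    split_ifs
    · rfl
    · rw [← Equiv.sum_comp Fin.revPerm]
      simp [ih]

lemma rev_hitMean (i j : Fin (n + 1)) : c.rev.hitMean i.rev j.rev = c.hitMean i j := by
  simp only [hitMean, rev_hitSurv]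

lemma rev_hitVar (i j : Fin (n + 1)) : c.rev.hitVar i.rev j.rev = c.hitVar i j := by
  simp only [hitVar, rev_hitMean, rev_hitSurv]

end BDChain

/-- Summing a tail sequence `S` and its weighted version through iterated potentials `H`, `G`. -/
lemma hasSum_of_potentials {S H G : ℕ → ℝ} {C : ℝ} (hS : ∀ m, 0 ≤ S m) (hH : ∀ m, 0 ≤ H m)
    (hG : ∀ m, 0 ≤ G m) (hHS : ∀ m, H m ≤ C * S m) (hGS : ∀ m, G m ≤ C * S m)
    (hH' : ∀ m, H m = S m + H (m + 1)) (hG' : ∀ m, G m = 2 * H m - S m + G (m + 1)) :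
    HasSum S (H 0) ∧ HasSum (fun m : ℕ => (2 * (m : ℝ) + 1) * S m) (G 0) := by
  have h1 (N : ℕ) : ∑ m ∈ Finset.range N, S m = H 0 - H N := by
    induction N with
    | zero => simp
    | succ N ih => rw [Finset.sum_range_succ, ih]; linarith [hH' N]
  have h2 (N : ℕ) : ∑ m ∈ Finset.range N, (2 * (m : ℝ) + 1) * S m =
      G 0 - G N - 2 * (N * H N) := by
    induction N with
    | zero => simp
    | succ N ih =>
      rw [Finset.sum_range_succ, ih]
      push_cast
      linear_combination (-2 * (N : ℝ) - 2) * hH' N - hG' N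
  have s1 : Summable S := summable_of_sum_range_le hS (c := H 0) fun N => by
    rw [h1]; linarith [hH N]
  have s2 : Summable (fun m : ℕ => (2 * (m : ℝ) + 1) * S m) :=
    summable_of_sum_range_le (fun m => mul_nonneg (by positivity) (hS m)) (c := G 0) fun N => by
      rw [h2]
      have : 0 ≤ (N : ℝ) * H N := mul_nonneg N.cast_nonneg (hH N)
      linarith [hG N]
  have t1 : Tendsto S atTop (nhds 0) := s1.tendsto_atTop_zero
  have t2 := s2.tendsto_atTop_zero
  have lH : Tendsto H atTop (nhds 0) :=
    squeeze_zero hH hHS (by simpa using t1.const_mul C)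
  have lG : Tendsto G atTop (nhds 0) :=
    squeeze_zero hG hGS (by simpa using t1.const_mul C)
  have lNH : Tendsto (fun N : ℕ => (N : ℝ) * H N) atTop (nhds 0) := by
    refine squeeze_zero (fun N => mul_nonneg N.cast_nonneg (hH N)) (fun N => ?_)
      (by simpa using t2.const_mul |C|)
    calc (N : ℝ) * H N ≤ N * (|C| * S N) :=
          mul_le_mul_of_nonneg_left ((hHS N).trans
            (mul_le_mul_of_nonneg_right (le_abs_self C) (hS N))) N.cast_nonneg
      _ ≤ |C| * ((2 * (N : ℝ) + 1) * S N) := by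
          have : 0 ≤ |C| * S N := mul_nonneg (abs_nonneg C) (hS N)
          have : (0 : ℝ) ≤ N := N.cast_nonneg
          nlinarith
  refine ⟨?_, ?_⟩
  · convert s1.hasSum
    refine tendsto_nhds_unique ?_ s1.hasSum.tendsto_sum_nat
    simp only [h1]
    simpa using lH.const_sub (H 0)
  · convert s2.hasSum
    refine tendsto_nhds_unique ?_ s2.hasSum.tendsto_sum_nat
    simp only [h2]
    simpa using (lG.const_sub (G 0)).sub (lNH.const_mul 2)

namespace BDChain

variable {n : ℕ} (c : BDChain n)

lemma hasSum_upSurv {i : ℕ} (hi : i ≤ n) (x : Fin (n + 1)) :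
    HasSum (fun m => c.upSurv i m x) (c.upMean i x) ∧
    HasSum (fun m : ℕ => (2 * (m : ℝ) + 1) * c.upSurv i m x)
      (c.upVar i x + c.upMean i x ^ 2) := by
  set h : Fin (n + 1) → ℝ := fun y => c.upMean i y with hh
  set g : Fin (n + 1) → ℝ := fun y => c.upVar i y + c.upMean i y ^ 2 with hg
  set ind : Fin (n + 1) → ℝ := fun y => if (y : ℕ) < i then 1 else 0 with hind
  have z1 (k : ℕ) (hk : i ≤ k) : c.upMean i k = 0 := by
    rw [upMean, Finset.Ico_eq_empty (by omega)]; rfl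
  have z2 (k : ℕ) (hk : i ≤ k) : c.upVar i k = 0 := by
    rw [upVar, Finset.Ico_eq_empty (by omega)]; rfl
  have eh : h = ind + c.upK i *ᵥ h := by
    ext y
    rw [Pi.add_apply, upK_mulVec]
    by_cases hy : (y : ℕ) < i
    · simp only [hh, hind, if_pos hy]
      rw [c.sum_K_mul_upMean hi hy]; ring
    · simp only [hh, hind, if_neg hy]
      rw [z1 y (not_lt.1 hy)]; ring
  have eg : g = (2 : ℝ) • h - ind + c.upK i *ᵥ g := by
    ext y
    rw [Pi.add_apply, upK_mulVec, Pi.sub_apply, Pi.smul_apply, smul_eq_mul]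
    by_cases hy : (y : ℕ) < i
    · simp only [hg, hh, hind, if_pos hy]
      have k1 := c.sum_K_mul_upVar hi hy (-1)
      simp only [neg_add_cancel, add_zero] at k1
      rw [k1]; ring
    · simp only [hg, hh, hind, if_neg hy]
      rw [z1 y (not_lt.1 hy), z2 y (not_lt.1 hy)]; ring
  obtain ⟨C, hC⟩ : ∃ C : ℝ, ∀ y, h y ≤ C ∧ g y ≤ C := by
    obtain ⟨A, hA⟩ := (Set.finite_range h).bddAbove
    obtain ⟨B, hB⟩ := (Set.finite_range g).bddAbove
    exact ⟨max A B, fun y => ⟨(hA ⟨y, rfl⟩).trans (le_max_left _ _),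
      (hB ⟨y, rfl⟩).trans (le_max_right _ _)⟩⟩
  have zero_le {f : Fin (n + 1) → ℝ} (hf : 0 ≤ f) (m : ℕ) : 0 ≤ (c.upK i ^ m *ᵥ f) x := by
    have := c.upK_pow_mulVec_mono i m hf x
    simpa using this
  have le_C {f : Fin (n + 1) → ℝ} (hf : f ≤ C • ind) (m : ℕ) :
      (c.upK i ^ m *ᵥ f) x ≤ C * (c.upK i ^ m *ᵥ ind) x := by
    have := c.upK_pow_mulVec_mono i m hf x
    rwa [Matrix.mulVec_smul] at this
  have h0 : 0 ≤ h := fun y => c.upMean_nonneg i y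
  have g0 : 0 ≤ g := fun y => add_nonneg (c.upVar_nonneg i y) (sq_nonneg _)
  have hI : h ≤ C • ind := fun y => by
    by_cases hy : (y : ℕ) < i
    · simpa [hind, hy] using (hC y).1
    · simp [hind, hy, hh, z1 y (not_lt.1 hy)]
  have gI : g ≤ C • ind := fun y => by
    by_cases hy : (y : ℕ) < i
    · simpa [hind, hy] using (hC y).2
    · simp [hind, hy, hg, z1 y (not_lt.1 hy), z2 y (not_lt.1 hy)]
  have key := hasSum_of_potentials (S := fun m => c.upSurv i m x)
    (H := fun m => (c.upK i ^ m *ᵥ h) x) (G := fun m => (c.upK i ^ m *ᵥ g) x) (C := C)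
    (fun m => c.upSurv_nonneg i m x) (zero_le h0) (zero_le g0) (le_C hI) (le_C gI)
    (fun m => by
      conv_lhs => rw [eh]
      rw [Matrix.mulVec_add, Matrix.mulVec_mulVec, ← pow_succ]; rfl)
    (fun m => by
      conv_lhs => rw [eg]
      rw [Matrix.mulVec_add, Matrix.mulVec_mulVec, ← pow_succ, Matrix.mulVec_sub,
        Matrix.mulVec_smul]
      rfl)
  simpa [hh, hg] using key

lemma hitMean_zero_left (i : Fin (n + 1)) : c.hitMean i 0 = c.upMean i 0 := by
  simp only [hitMean, c.hitSurv_eq_upSurv i 0 (Fin.zero_le i)]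
  exact (c.hasSum_upSurv (Nat.le_of_lt_succ i.isLt) 0).1.tsum_eq

lemma hitVar_zero_left (i : Fin (n + 1)) : c.hitVar i 0 = c.upVar i 0 := by
  rw [hitVar, hitMean_zero_left]
  simp only [c.hitSurv_eq_upSurv i 0 (Fin.zero_le i)]
  rw [(c.hasSum_upSurv (Nat.le_of_lt_succ i.isLt) 0).2.tsum_eq]
  simp

lemma hitMean_last (i : Fin (n + 1)) : c.hitMean i (Fin.last n) = c.rev.upMean i.rev 0 := by
  rw [← rev_hitMean, Fin.rev_last, hitMean_zero_left]

lemma hitVar_last (i : Fin (n + 1)) : c.hitVar i (Fin.last n) = c.rev.upVar i.rev 0 := by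
  rw [← rev_hitVar, Fin.rev_last, hitVar_zero_left]

end BDChain

/-- The square of a sum is at most twice its sum over ordered pairs. -/
lemma sq_sum_Ico_le (x : ℕ → ℝ) (j M : ℕ) :
    (∑ k ∈ Finset.Ico j M, x k) ^ 2 / 2 ≤
      ∑ l ∈ Finset.Ico j M, x l * ∑ k ∈ Finset.Ico j (l + 1), x k := by
  rcases lt_or_ge M j with h | h
  · rw [Finset.Ico_eq_empty (by omega)]; simp
  induction M, h using Nat.le_induction with
  | base => simp
  | succ M h ih =>
    rw [Finset.sum_Ico_succ_top h, Finset.sum_Ico_succ_top h, Finset.sum_Ico_succ_top h]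
    nlinarith [sq_nonneg (x M)]

namespace BDChain

variable {n : ℕ}

/-- The effective resistance between `j` and `i`. -/
def resist (c : BDChain n) (j i : ℕ) : ℝ := ∑ k ∈ Finset.Ico j i, (c.edgeWt k)⁻¹

/-- `π([k,n])` for a natural number `k`. -/
def cumHigh (c : BDChain n) (k : ℕ) : ℝ :=
  ∑ x : Fin (n + 1), if k ≤ (x : ℕ) then c.pi x else 0

variable (c : BDChain n)

lemma inv_edgeWt_nonneg (k : ℕ) : 0 ≤ (c.edgeWt k)⁻¹ := inv_nonneg.2 (c.edgeWt_nonneg k)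

lemma resist_nonneg (j i : ℕ) : 0 ≤ c.resist j i :=
  Finset.sum_nonneg fun k _ => c.inv_edgeWt_nonneg k

lemma half_mul_sq_le_upVar {δ : ℝ} (hδ0 : 0 ≤ δ) (hδ : ∀ x, δ ≤ c.K x x) (j : ℕ) {i : ℕ}
    (hi : i ≤ n) : δ / 2 * (c.cum j * c.resist j i) ^ 2 ≤ c.upVar i 0 := by
  have h1 := sq_sum_Ico_le (fun k => (c.edgeWt k)⁻¹) j i
  have h2 : δ * c.cum j ^ 2 * ∑ l ∈ Finset.Ico j i, (c.edgeWt l)⁻¹ *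
      ∑ k ∈ Finset.Ico j (l + 1), (c.edgeWt k)⁻¹ ≤ c.upVar i 0 := by
    calc _ ≤ ∑ l ∈ Finset.Ico j i, c.stepVar l := by
          rw [Finset.mul_sum]
          refine Finset.sum_le_sum fun l hl => ?_
          rw [Finset.mem_Ico] at hl
          refine le_trans ?_ (c.mul_div_le_stepVar hδ0 hδ (by omega))
          rw [div_eq_mul_inv, mul_comm _ (c.edgeWt l)⁻¹, mul_left_comm]
          refine mul_le_mul_of_nonneg_left ?_ (c.inv_edgeWt_nonneg l)
          rw [mul_assoc]
          refine mul_le_mul_of_nonneg_left ?_ hδ0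
          calc c.cum j ^ 2 * ∑ k ∈ Finset.Ico j (l + 1), (c.edgeWt k)⁻¹
              ≤ ∑ k ∈ Finset.Ico j (l + 1), c.cumSqDiv k := by
                rw [Finset.mul_sum]
                refine Finset.sum_le_sum fun k hk => ?_
                rw [Finset.mem_Ico] at hk
                exact mul_le_mul_of_nonneg_right
                  (pow_le_pow_left₀ (c.cum_pos j).le (c.cum_mono hk.1) 2)
                  (c.inv_edgeWt_nonneg k)
            _ ≤ _ := Finset.sum_le_sum_of_subset_of_nonneg
                (fun k hk => by rw [Finset.mem_Ico] at hk; rw [Finset.mem_range]; omega)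
                fun k _ _ => c.cumSqDiv_nonneg k
      _ ≤ c.upVar i 0 := Finset.sum_le_sum_of_subset_of_nonneg
          (fun k hk => by rw [Finset.mem_Ico] at hk ⊢; omega)
          fun k _ _ => c.stepVar_nonneg k
  refine le_trans ?_ h2
  calc δ / 2 * (c.cum j * c.resist j i) ^ 2 = δ * c.cum j ^ 2 * (c.resist j i ^ 2 / 2) := by ring
    _ ≤ _ := mul_le_mul_of_nonneg_left h1 (mul_nonneg hδ0 (sq_nonneg _))

lemma upVar_le {i : ℕ} {B : ℝ} (hB : ∀ k, k < i → c.cum k * c.resist k i ≤ B) :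
    c.upVar i 0 ≤ 2 * B * c.upMean i 0 := by
  calc c.upVar i 0 ≤ ∑ l ∈ Finset.Ico 0 i, ∑ k ∈ Finset.Ico 0 (l + 1),
        2 * (c.cumSqDiv k * (c.edgeWt l)⁻¹) := by
        refine Finset.sum_le_sum fun l _ => (c.stepVar_le l).trans_eq ?_
        rw [div_eq_mul_inv, ← Finset.mul_sum, ← Finset.sum_mul, Finset.range_eq_Ico, mul_assoc]
    _ = ∑ k ∈ Finset.Ico 0 i, ∑ l ∈ Finset.Ico k i, 2 * (c.cumSqDiv k * (c.edgeWt l)⁻¹) :=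
        (Finset.sum_Ico_Ico_comm 0 i _).symm
    _ ≤ ∑ k ∈ Finset.Ico 0 i, 2 * B * c.stepMean k := by
        refine Finset.sum_le_sum fun k hk => ?_
        rw [← Finset.mul_sum, ← Finset.mul_sum]
        change 2 * (c.cumSqDiv k * c.resist k i) ≤ _
        have h1 := hB k (Finset.mem_Ico.1 hk).2
        have h2 : c.cumSqDiv k = c.stepMean k * c.cum k := by
          rw [cumSqDiv, stepMean]; ring
        rw [h2]
        nlinarith [c.stepMean_nonneg k]
    _ = _ := by rw [← Finset.mul_sum]; rfl

lemma cum_mul_resist_le (k i : ℕ) : c.cum k * c.resist k i ≤ c.upMean i 0 := by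
  calc c.cum k * c.resist k i ≤ ∑ l ∈ Finset.Ico k i, c.stepMean l := by
        rw [resist, Finset.mul_sum]
        refine Finset.sum_le_sum fun l hl => ?_
        exact mul_le_mul_of_nonneg_right (c.cum_mono (Finset.mem_Ico.1 hl).1)
          (c.inv_edgeWt_nonneg l)
    _ ≤ _ := Finset.sum_le_sum_of_subset_of_nonneg
          (fun k hk => by rw [Finset.mem_Ico] at hk ⊢; omega) fun k _ _ => c.stepMean_nonneg k

lemma upMean_le_resist {M x i : ℕ} (h : M ≤ x) : c.upMean i x ≤ c.resist M i := by
  calc c.upMean i x ≤ ∑ k ∈ Finset.Ico x i, (c.edgeWt k)⁻¹ := by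
        refine Finset.sum_le_sum fun k _ => ?_
        rw [stepMean, div_eq_mul_inv]
        exact mul_le_of_le_one_left (c.inv_edgeWt_nonneg k) (c.cum_le_one k)
    _ ≤ _ := Finset.sum_le_sum_of_subset_of_nonneg
          (fun k hk => by rw [Finset.mem_Ico] at hk ⊢; omega) fun k _ _ => c.inv_edgeWt_nonneg k

lemma upMean_add {Q M : ℕ} (h : Q ≤ M) : c.upMean Q 0 + c.upMean M Q = c.upMean M 0 :=
  Finset.sum_Ico_consecutive _ (Nat.zero_le _) h

lemma upVar_mono {x Q M : ℕ} (h : Q ≤ M) : c.upVar Q x ≤ c.upVar M 0 :=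
  Finset.sum_le_sum_of_subset_of_nonneg
    (fun k hk => by rw [Finset.mem_Ico] at hk ⊢; omega) fun k _ _ => c.stepVar_nonneg k

lemma upMean_le_upMean (x M : ℕ) : c.upMean M x ≤ c.upMean M 0 :=
  Finset.sum_le_sum_of_subset_of_nonneg
    (fun k hk => by rw [Finset.mem_Ico] at hk ⊢; omega) fun k _ _ => c.stepMean_nonneg k

lemma one_le_stepMean {k : ℕ} (hk : k < n) : 1 ≤ c.stepMean k := by
  rw [stepMean, one_le_div (c.edgeWt_pos hk), edgeWt, dif_pos hk]
  refine le_trans ?_ (c.pi_le_cum ⟨k, by omega⟩)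
  refine mul_le_of_le_one_right (c.pi_pos _).le ?_
  rw [← c.K_rowSum ⟨k, by omega⟩]
  exact Finset.single_le_sum (fun y _ => c.K_nonneg _ y) (Finset.mem_univ _)

lemma le_upMean {i : ℕ} (hi : i ≤ n) : (i : ℝ) ≤ c.upMean i 0 := by
  calc (i : ℝ) = ∑ k ∈ Finset.Ico 0 i, (1 : ℝ) := by simp
    _ ≤ _ := Finset.sum_le_sum fun k hk =>
        c.one_le_stepMean ((Finset.mem_Ico.1 hk).2.trans_le hi)

lemma half_le_upVar {δ : ℝ} (hδ0 : 0 ≤ δ) (hδ : ∀ x, δ ≤ c.K x x) {i : ℕ} (hi : i ≤ n)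
    (hi0 : 0 < i) : δ / 2 ≤ c.upVar i 0 := by
  refine le_trans ?_ (c.half_mul_sq_le_upVar hδ0 hδ (i - 1) hi)
  have h : c.cum (i - 1) * c.resist (i - 1) i = c.stepMean (i - 1) := by
    obtain ⟨k, rfl⟩ : ∃ k, i = k + 1 := ⟨i - 1, by omega⟩
    simp [resist, stepMean, div_eq_mul_inv]
  have h1 := c.one_le_stepMean (k := i - 1) (by omega)
  rw [h]
  exact le_mul_of_one_le_right (by linarith) (one_le_pow₀ h1)

lemma rev_resist {M Q : ℕ} (hQ : Q ≤ n) : c.rev.resist (n - Q) (n - M) = c.resist M Q := by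
  rcases lt_or_ge Q M with h | h
  · rw [resist, resist, Finset.Ico_eq_empty (by omega), Finset.Ico_eq_empty (by omega)]
    rfl
  rcases Nat.eq_zero_or_pos n with h0 | h0
  · rw [resist, resist, Finset.Ico_eq_empty (by omega), Finset.Ico_eq_empty (by omega)]
    rfl
  have := Finset.sum_Ico_reflect (fun k => (c.rev.edgeWt k)⁻¹) M (m := Q) (n := n - 1) (by omega)
  rw [resist, resist, show n - Q = n - 1 + 1 - Q by omega, show n - M = n - 1 + 1 - M by omega,
    ← this]
  exact Finset.sum_congr rfl fun k hk => by
    rw [c.rev_edgeWt (by have := Finset.mem_Ico.1 hk; omega)]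

lemma rev_cum {Q : ℕ} (hQ : Q ≤ n) : c.rev.cum (n - Q) = c.cumHigh Q := by
  rw [cum, cumHigh, ← Equiv.sum_comp Fin.revPerm]
  refine Finset.sum_congr rfl fun x _ => ?_
  simp only [Fin.revPerm_apply, rev_pi, Fin.rev_rev, Fin.val_rev]
  have := x.isLt
  by_cases h : Q ≤ (x : ℕ)
  · rw [if_pos h, if_pos (by omega)]
  · rw [if_neg h, if_neg (by omega)]

lemma piLow_eq (M : Fin (n + 1)) : c.piLow M = c.cum M := rfl

lemma piHigh_eq (M : Fin (n + 1)) : c.piHigh M = c.cumHigh M := rfl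

lemma rev_rev : c.rev.rev = c := by
  cases c
  simp [rev, Fin.rev_rev]
  rfl

lemma cumHigh_le_one (k : ℕ) : c.cumHigh k ≤ 1 := by
  rw [← c.pi_sum]
  refine Finset.sum_le_sum fun x _ => ?_
  split_ifs
  exacts [le_rfl, (c.pi_pos x).le]

lemma cumHigh_nonneg (k : ℕ) : 0 ≤ c.cumHigh k :=
  Finset.sum_nonneg fun x _ => by split_ifs; exacts [(c.pi_pos x).le, le_rfl]

/-- The Poincaré inequality with constant `l`. -/
def Poincare (c : BDChain n) (l : ℝ) : Prop :=
  ∀ f : Fin (n + 1) → ℝ, l * ∑ x, c.pi x * (f x - ∑ y, c.pi y * f y) ^ 2 ≤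
    ∑ x, c.pi x * (f x * (f x - ∑ y, c.K x y * f y))

lemma Poincare.mul_resist_le {c : BDChain n} {l : ℝ} (hl : c.Poincare l) (hl0 : 0 ≤ l) {j M : ℕ}
    (hj : j < M) (hM : M ≤ n) : l * (c.cum j * c.cumHigh M * c.resist j M) ≤ 2 := by
  set F : ℕ → ℝ := fun k => c.resist (max k j) M with hF
  set μ := ∑ y, c.pi y * F y with hμ
  set R := c.resist j M with hR
  have hRpos : 0 < R :=
    Finset.sum_pos (fun k hk => inv_pos.2 (c.edgeWt_pos (by have := Finset.mem_Ico.1 hk; omega)))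
      ⟨j, Finset.mem_Ico.2 ⟨le_rfl, hj⟩⟩
  have h1 := hl fun x => F x
  have hstep (k : ℕ) (hk : k < n) :
      c.edgeWt k * (F (k + 1) - F k) = if j ≤ k ∧ k < M then -1 else 0 := by
    split_ifs with h
    · have : F k = (c.edgeWt k)⁻¹ + F (k + 1) := by
        simp only [hF]
        rw [max_eq_left h.1, max_eq_left (by omega), resist, resist, sum_Ico_eq_add _ h.2]
      have h0 := (c.edgeWt_pos hk).ne'
      rw [this]
      field_simp
      ring
    · by_cases h' : j ≤ k
      · simp only [hF]
        rw [resist, resist, Finset.Ico_eq_empty (by omega), Finset.Ico_eq_empty (by omega)]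
        simp
      · simp only [hF]
        rw [max_eq_right (by omega), max_eq_right (by omega)]
        simp
  have hd (x : Fin (n + 1)) : c.pi x * (F x - ∑ y, c.K x y * F y) =
      (if (x : ℕ) = j then 1 else 0) - (if (x : ℕ) = M then 1 else 0) := by
    rw [c.sum_K_mul]
    have := c.generator F x
    have e : c.pi x * (F x - (F x + ∑ y, c.K x y * (F y - F x))) =
        -(c.edgeWt x * (F (x + 1) - F x)) - c.prevWt x * (F (x - 1) - F x) := by
      linarith
    rw [e]
    have e1 : c.edgeWt x * (F (x + 1) - F x) = if j ≤ (x : ℕ) ∧ (x : ℕ) < M then -1 else 0 := by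
      rcases lt_or_ge (x : ℕ) n with h | h
      · exact hstep x h
      · rw [c.edgeWt_of_le h, if_neg (by omega), zero_mul]
    have e2 : c.prevWt x * (F (x - 1) - F x) =
        if j + 1 ≤ (x : ℕ) ∧ (x : ℕ) ≤ M then 1 else 0 := by
      obtain ⟨x, hx⟩ := x
      cases x with
      | zero => simp [prevWt]
      | succ k =>
        have := hstep k (by omega)
        simp only [prevWt, Nat.add_sub_cancel]
        by_cases h : j ≤ k ∧ k < M
        · rw [if_pos h] at this
          rw [if_pos (by omega)]; linarith
        · rw [if_neg h] at this
          rw [if_neg (by omega)]; linarith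
    rw [e1, e2]
    rcases lt_trichotomy (x : ℕ) j with h | h | h
    · rw [if_neg (by omega), if_neg (by omega), if_neg (by omega), if_neg (by omega)]; norm_num
    · rw [if_pos (by omega), if_neg (by omega), if_pos (by omega), if_neg (by omega)]; norm_num
    · rcases lt_trichotomy (x : ℕ) M with h' | h' | h'
      · rw [if_pos (by omega), if_pos (by omega), if_neg (by omega), if_neg (by omega)]; norm_num
      · rw [if_neg (by omega), if_pos (by omega), if_neg (by omega), if_pos (by omega)]; norm_num
      · rw [if_neg (by omega), if_neg (by omega), if_neg (by omega), if_neg (by omega)]; norm_num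
  have hE : ∑ x : Fin (n + 1), c.pi x * (F x * (F x - ∑ y, c.K x y * F y)) = R := by
    have : ∀ x : Fin (n + 1), c.pi x * (F x * (F x - ∑ y, c.K x y * F y)) =
        if (x : ℕ) = j then R else 0 := fun x => by
      rw [mul_left_comm, hd]
      by_cases h : (x : ℕ) = j
      · rw [if_pos h, if_neg (by omega), if_pos h, h]
        simp [hF, hR]
      · by_cases h' : (x : ℕ) = M
        · have : F M = 0 := by
            simp only [hF]
            rw [resist, Finset.Ico_eq_empty (by omega)]; rfl
          rw [if_neg h, if_neg h, h', this, zero_mul]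
        · rw [if_neg h, if_neg h, if_neg h']; simp
    rw [Finset.sum_congr rfl fun x _ => this x, Finset.sum_eq_single ⟨j, by omega⟩]
    · simp
    · intro y _ hy
      exact if_neg fun e => hy (Fin.ext e)
    · simp
  have hV : c.cum j * (R - μ) ^ 2 + c.cumHigh M * μ ^ 2 ≤
      ∑ x : Fin (n + 1), c.pi x * (F x - μ) ^ 2 := by
    rw [cum, cumHigh, Finset.sum_mul, Finset.sum_mul, ← Finset.sum_add_distrib]
    refine Finset.sum_le_sum fun x _ => ?_
    have hp := (c.pi_pos x).le
    by_cases h : (x : ℕ) ≤ j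
    · rw [if_pos h, if_neg (by omega)]
      simp [hF, hR, max_eq_right h]
    · by_cases h' : M ≤ (x : ℕ)
      · have : F x = 0 := by
          simp only [hF]
          rw [resist, Finset.Ico_eq_empty (by omega)]; rfl
        rw [if_neg h, if_pos h', this]
        simp
      · rw [if_neg h, if_neg h', zero_mul, zero_mul, add_zero]
        positivity
  rw [hE] at h1
  have ha := c.cum_pos j
  have ha1 := c.cum_le_one j
  have hb := c.cumHigh_nonneg M
  have hb1 := c.cumHigh_le_one M
  set a := c.cum j
  set b := c.cumHigh M
  have h2 : a * b * R ^ 2 / 2 ≤ a * (R - μ) ^ 2 + b * μ ^ 2 := by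
    have i1 : a * b * (R - μ) ^ 2 ≤ a * (R - μ) ^ 2 :=
      mul_le_mul_of_nonneg_right (mul_le_of_le_one_right ha.le hb1) (sq_nonneg _)
    have i2 : a * b * μ ^ 2 ≤ b * μ ^ 2 :=
      mul_le_mul_of_nonneg_right (mul_le_of_le_one_left hb ha1) (sq_nonneg _)
    have i3 : R ^ 2 / 2 ≤ (R - μ) ^ 2 + μ ^ 2 := by nlinarith [sq_nonneg (R - 2 * μ)]
    have i4 := mul_le_mul_of_nonneg_left i3 (mul_nonneg ha.le hb)
    linarith
  have h3 : l * (a * b * R ^ 2 / 2) ≤ R :=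
    (mul_le_mul_of_nonneg_left (h2.trans hV) hl0).trans h1
  refine le_of_mul_le_mul_right ?_ hRpos
  linarith

end BDChain

lemma mul_dotProduct_le_of_eigenvectors {ι : Type*} [Fintype ι] [DecidableEq ι]
    {A : Matrix ι ι ℝ} (hA : A.IsSymm) (g : ι → ℝ) (l : ℝ)
    (h : ∀ (v : ι → ℝ) (μ : ℝ), A *ᵥ v = μ • v → v ⬝ᵥ g ≠ 0 → l ≤ μ) :
    l * (g ⬝ᵥ g) ≤ g ⬝ᵥ (A *ᵥ g) := by
  have hH : A.IsHermitian := by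
    rw [Matrix.IsHermitian, Matrix.conjTranspose_eq_transpose_of_trivial]; exact hA
  set e : ι → ι → ℝ := fun k => (hH.eigenvectorBasis k).ofLp
  have he : ∀ k, A *ᵥ e k = hH.eigenvalues k • e k := hH.mulVec_eigenvectorBasis
  have parseval : ∀ u w : ι → ℝ, u ⬝ᵥ w = ∑ k, (e k ⬝ᵥ u) * (e k ⬝ᵥ w) := fun u w => by
    have := hH.eigenvectorBasis.sum_inner_mul_inner (WithLp.toLp 2 u) (WithLp.toLp 2 w)
    simp only [EuclideanSpace.inner_eq_star_dotProduct, star_trivial] at this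
    rw [dotProduct_comm, ← this]
    exact Finset.sum_congr rfl fun k _ => by rw [dotProduct_comm w]
  rw [parseval g g, parseval g (A *ᵥ g), Finset.mul_sum]
  refine Finset.sum_le_sum fun k _ => ?_
  have : e k ⬝ᵥ (A *ᵥ g) = hH.eigenvalues k * (e k ⬝ᵥ g) := by
    rw [Matrix.dotProduct_mulVec, ← Matrix.mulVec_transpose, hA.eq, he, smul_dotProduct,
      smul_eq_mul]
  rw [this]
  by_cases h0 : e k ⬝ᵥ g = 0
  · simp [h0]
  · have := mul_le_mul_of_nonneg_right (h _ _ (he k) h0) (mul_self_nonneg (e k ⬝ᵥ g))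
    linarith

namespace BDChain

variable {n : ℕ} (c : BDChain n)

lemma pi_mul_K_comm (x y : Fin (n + 1)) : c.pi x * c.K x y = c.pi y * c.K y x := by
  rcases lt_trichotomy (x : ℕ) y with h | h | h
  · rcases eq_or_lt_of_le (Nat.succ_le_of_lt h) with h' | h'
    · exact c.detailed_balance h'.symm
    · rw [c.K_eq_zero (Or.inl h'), c.K_eq_zero (Or.inr h'), mul_zero, mul_zero]
  · rw [Fin.ext h]
  · rcases eq_or_lt_of_le (Nat.succ_le_of_lt h) with h' | h'
    · exact (c.detailed_balance h'.symm).symm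
    · rw [c.K_eq_zero (Or.inr h'), c.K_eq_zero (Or.inl h'), mul_zero, mul_zero]

lemma eq_of_harmonic {w : Fin (n + 1) → ℝ} (hw : ∀ x, ∑ y, c.K x y * w y = w x)
    (x : Fin (n + 1)) : w x = w 0 := by
  set F : ℕ → ℝ := fun k => if h : k < n + 1 then w ⟨k, h⟩ else 0 with hF
  have hFw : ∀ y : Fin (n + 1), F y = w y := fun y => dif_pos y.isLt
  have hG : ∀ y : Fin (n + 1),
      c.edgeWt y * (F (y + 1) - F y) + c.prevWt y * (F (y - 1) - F y) = 0 := fun y => by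
    rw [← c.generator]
    have := c.sum_K_mul F y
    simp only [hFw] at this ⊢
    rw [hw] at this
    rw [left_eq_add.1 this, mul_zero]
  have hstep : ∀ k, k < n → F (k + 1) = F k := fun k => by
    induction k with
    | zero =>
      intro h
      have := hG 0
      simp only [Fin.val_zero, prevWt, zero_mul, add_zero, mul_eq_zero, sub_eq_zero] at this
      exact this.resolve_left (c.edgeWt_pos h).ne'
    | succ k ih =>
      intro h
      have := hG ⟨k + 1, by omega⟩
      simp only [prevWt, Nat.add_sub_cancel, ih (by omega), sub_self, mul_zero, add_zero,
        mul_eq_zero, sub_eq_zero] at this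
      rw [this.resolve_left (c.edgeWt_pos h).ne', ih (by omega)]
  have hall : ∀ k, k ≤ n → F k = F 0 := fun k => by
    induction k with
    | zero => intro _; rfl
    | succ k ih => intro h; rw [hstep k (by omega), ih (by omega)]
  have := hall x (Nat.le_of_lt_succ x.isLt)
  rwa [hFw, show F 0 = w 0 from hFw 0] at this

lemma sum_pi_mul_sum_K (f : Fin (n + 1) → ℝ) :
    ∑ x, c.pi x * ∑ y, c.K x y * f y = ∑ x, c.pi x * f x := by
  simp only [Finset.mul_sum]
  rw [Finset.sum_comm]
  refine Finset.sum_congr rfl fun y _ => ?_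
  simp only [← mul_assoc]
  rw [← Finset.sum_mul, c.pi_stat]

lemma poincare_of_isSmallestNonzeroEig {l : ℝ} (hl : IsSmallestNonzeroEig (1 - c.K) l) :
    c.Poincare l := by
  intro f
  set m := ∑ y, c.pi y * f y with hm
  set s : Fin (n + 1) → ℝ := fun x => √(c.pi x) with hs
  have hs0 : ∀ x, s x ≠ 0 := fun x => (Real.sqrt_pos.2 (c.pi_pos x)).ne'
  have hss : ∀ x, s x * s x = c.pi x := fun x => Real.mul_self_sqrt (c.pi_pos x).le
  set A : Matrix (Fin (n + 1)) (Fin (n + 1)) ℝ :=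
    Matrix.of fun x y => s x * (1 - c.K) x y / s y with hA
  have hAapply : ∀ v : Fin (n + 1) → ℝ, ∀ x,
      (A *ᵥ fun y => s y * v y) x = s x * (v x - ∑ y, c.K x y * v y) := fun v x => by
    have : v x - ∑ y, c.K x y * v y = ((1 - c.K) *ᵥ v) x := by
      rw [Matrix.sub_mulVec, Matrix.one_mulVec]; rfl
    rw [this]
    simp only [Matrix.mulVec, dotProduct, hA, Matrix.of_apply, Finset.mul_sum]
    refine Finset.sum_congr rfl fun y _ => ?_
    have := hs0 y
    field_simp
  have hsymm : A.IsSymm := by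
    ext x y
    simp only [Matrix.transpose_apply, hA, Matrix.of_apply, Matrix.sub_apply]
    rw [div_eq_div_iff (hs0 _) (hs0 _)]
    have h1 : (1 : Matrix (Fin (n + 1)) (Fin (n + 1)) ℝ) y x = (1 : Matrix _ _ ℝ) x y := by
      rw [Matrix.one_apply, Matrix.one_apply]; simp [eq_comm]
    have h3 : s x * s x * (1 : Matrix (Fin (n + 1)) (Fin (n + 1)) ℝ) x y =
        s y * s y * (1 : Matrix _ _ ℝ) x y := by
      rcases eq_or_ne x y with rfl | h
      · rfl
      · simp [h]
    have h2 := c.pi_mul_K_comm x y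
    rw [← hss, ← hss] at h2
    rw [h1]
    linarith
  have hmean : ∑ x, c.pi x * (f x - m) = 0 := by
    simp only [mul_sub, Finset.sum_sub_distrib, ← Finset.sum_mul, c.pi_sum, ← hm]
    ring
  have key := mul_dotProduct_le_of_eigenvectors hsymm (fun x => s x * (f x - m)) l ?_
  · have e1 : (fun x => s x * (f x - m)) ⬝ᵥ (fun x => s x * (f x - m)) =
        ∑ x, c.pi x * (f x - m) ^ 2 :=
      Finset.sum_congr rfl fun x _ => by rw [← hss]; ring
    have e2 : (fun x => s x * (f x - m)) ⬝ᵥ (A *ᵥ fun x => s x * (f x - m)) =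
        ∑ x, c.pi x * (f x * (f x - ∑ y, c.K x y * f y)) := by
      have : ∀ x, s x * (f x - m) * (A *ᵥ fun x => s x * (f x - m)) x =
          c.pi x * (f x * (f x - ∑ y, c.K x y * f y)) -
            m * (c.pi x * f x - c.pi x * ∑ y, c.K x y * f y) := fun x => by
        rw [hAapply]
        have := c.sum_K_mul_add x f (-m)
        simp only [← sub_eq_add_neg] at this
        rw [this, ← hss]
        ring
      rw [dotProduct, Finset.sum_congr rfl fun x _ => this x, Finset.sum_sub_distrib,
        ← Finset.mul_sum, Finset.sum_sub_distrib, sum_pi_mul_sum_K]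
      ring
    rwa [e1, e2] at key
  · intro v μ hv hvg
    set w : Fin (n + 1) → ℝ := fun x => v x / s x with hw
    have hvw : v = fun x => s x * w x := by
      funext x
      rw [hw]
      exact (mul_div_cancel₀ _ (hs0 x)).symm
    have hwe : ∀ x, w x - ∑ y, c.K x y * w y = μ * w x := fun x => by
      have := congrFun hv x
      rw [hvw, hAapply, Pi.smul_apply, smul_eq_mul] at this
      exact mul_left_cancel₀ (hs0 x) (by linarith)
    refine hl.2.2 μ ⟨w, ?_, ?_⟩ ?_
    · rintro h0
      refine hvg ?_
      rw [hvw, h0]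
      simp [dotProduct]
    · funext x
      rw [Matrix.sub_mulVec, Matrix.one_mulVec]
      exact hwe x
    · rintro rfl
      refine hvg ?_
      have hc := c.eq_of_harmonic (w := w) fun x => by have := hwe x; linarith
      have : v ⬝ᵥ (fun x => s x * (f x - m)) = ∑ x, w 0 * (c.pi x * (f x - m)) :=
        Finset.sum_congr rfl fun x _ => by
          rw [hvw, ← hss, ← hc x]; ring
      rw [this, ← Finset.mul_sum, hmean, mul_zero]

end BDChain

lemma derivative_bernstein_identity (p : ℝ) (k : ℕ) :
    C ((k + 1 : ℝ) * (1 - p)) * ((C p * X + C (1 - p)) ^ k * (C p * (X - 1))) =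
      ∑ j ∈ Finset.range (k + 1 + 1),
        C ((bernsteinPolynomial ℝ (k + 1) j).eval p * (j - (k + 1) * p)) * X ^ j := by
  have hP : (C p * X + C (1 - p)) ^ (k + 1) = ∑ j ∈ Finset.range (k + 1 + 1),
      C ((bernsteinPolynomial ℝ (k + 1) j).eval p) * X ^ j := by
    rw [add_pow]
    refine Finset.sum_congr rfl fun j _ => ?_
    simp only [bernsteinPolynomial, eval_mul, eval_pow, eval_natCast, eval_X, eval_sub, eval_one,
      map_mul, map_pow, map_natCast]
    ring
  have hD : ((k + 1 : ℕ) : ℝ[X]) * (C p * X + C (1 - p)) ^ k * C p * X =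
      ∑ j ∈ Finset.range (k + 1 + 1), C ((bernsteinPolynomial ℝ (k + 1) j).eval p * j) * X ^ j := by
    have := congrArg derivative hP
    rw [derivative_pow, derivative_sum] at this
    simp only [derivative_add, derivative_C_mul, derivative_X, derivative_C,
      Nat.add_sub_cancel, add_zero, mul_one] at this
    rw [map_natCast] at this
    rw [this, Finset.sum_mul]
    refine Finset.sum_congr rfl fun j _ => ?_
    rcases j with _ | j
    · simp
    · rw [derivative_X_pow, C_mul, C_eq_natCast, Nat.add_sub_cancel]
      ring
  have hsplit : ∑ j ∈ Finset.range (k + 1 + 1),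
      C ((bernsteinPolynomial ℝ (k + 1) j).eval p * (j - (k + 1) * p)) * X ^ j =
      ((k + 1 : ℕ) : ℝ[X]) * (C p * X + C (1 - p)) ^ k * C p * X -
        C ((k + 1 : ℝ) * p) * (C p * X + C (1 - p)) ^ (k + 1) := by
    rw [hD, hP, Finset.mul_sum, ← Finset.sum_sub_distrib]
    refine Finset.sum_congr rfl fun j _ => ?_
    rw [mul_sub, C_sub, C_mul (a := eval p _), C_mul (a := eval p _)]
    ring
  rw [hsplit]
  simp only [C_mul, C_sub, C_1, C_add, map_natCast]
  push_cast
  ring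

/-- For a lazy stochastic matrix, one further step changes `K ^ k *ᵥ f` by `O(k ^ (-1/2))`. -/
lemma mul_sq_pow_succ_mulVec_sub_le {ι : Type*} [Fintype ι] [DecidableEq ι] {K : Matrix ι ι ℝ}
    (hK : ∀ i j, 0 ≤ K i j) (hrow : ∀ i, ∑ j, K i j = 1) {δ : ℝ} (hδ0 : 0 < δ) (hδ1 : δ < 1)
    (hδ : ∀ i, δ ≤ K i i) {f : ι → ℝ} (hf0 : ∀ i, 0 ≤ f i) (hf1 : ∀ i, f i ≤ 1) (k : ℕ) (x : ι) :
    (k + 1) * δ * ((K ^ (k + 1) *ᵥ f) x - (K ^ k *ᵥ f) x) ^ 2 ≤ 1 := by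
  set p := 1 - δ with hp
  have hp0 : 0 < p := by linarith
  have hp1 : 1 - p = δ := by rw [hp]; ring
  set Y : Matrix ι ι ℝ := p⁻¹ • (K - δ • 1) with hY
  have hKY : p • Y + δ • 1 = K := by
    rw [hY, smul_smul, mul_inv_cancel₀ hp0.ne', one_smul, sub_add_cancel]
  have hYnn : ∀ i j, 0 ≤ Y i j := fun i j => by
    rw [hY, Matrix.smul_apply, Matrix.sub_apply, Matrix.smul_apply, smul_eq_mul, smul_eq_mul,
      Matrix.one_apply]
    refine mul_nonneg (inv_pos.2 hp0).le ?_
    split_ifs with h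
    · subst h; linarith [hδ i]
    · linarith [hK i j]
  have hYrow : ∀ i, ∑ j, Y i j = 1 := fun i => by
    simp only [hY, Matrix.smul_apply, Matrix.sub_apply, smul_eq_mul, Matrix.one_apply,
      ← Finset.mul_sum, Finset.sum_sub_distrib, hrow]
    simp only [Finset.sum_ite_eq, Finset.mem_univ, if_true, mul_one]
    exact inv_mul_cancel₀ hp0.ne'
  have ha : ∀ j i, 0 ≤ (Y ^ j *ᵥ f) i ∧ (Y ^ j *ᵥ f) i ≤ 1 := fun j => by
    induction j with
    | zero => intro i; simp [hf0, hf1]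
    | succ j ih =>
      intro i
      rw [pow_succ', ← Matrix.mulVec_mulVec]
      refine ⟨Finset.sum_nonneg fun y _ => mul_nonneg (hYnn _ _) (ih y).1, ?_⟩
      rw [← hYrow i]
      exact Finset.sum_le_sum fun y _ => mul_le_of_le_one_right (hYnn _ _) (ih y).2
  set a : ℕ → ℝ := fun j => (Y ^ j *ᵥ f) x with hadef
  set b : ℕ → ℝ := fun j => (bernsteinPolynomial ℝ (k + 1) j).eval p with hb
  have hb0 : ∀ j, 0 ≤ b j := fun j => by
    simp only [hb, bernsteinPolynomial, eval_mul, eval_pow, eval_natCast, eval_X, eval_sub,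
      eval_one, hp1]
    positivity
  have hb1 : ∑ j ∈ Finset.range (k + 1 + 1), b j = 1 := by
    have := congrArg (eval p) (bernsteinPolynomial.sum ℝ (k + 1))
    rwa [eval_finsetSum, eval_one] at this
  have hb2 : ∑ j ∈ Finset.range (k + 1 + 1), b j * (j - (k + 1) * p) ^ 2 =
      (k + 1) * p * δ := by
    have := congrArg (eval p) (bernsteinPolynomial.variance ℝ (k + 1))
    simp only [eval_finsetSum, eval_mul, eval_pow, eval_sub, eval_natCast, eval_X, eval_one,
      nsmul_eq_mul, hp1] at this
    push_cast at this
    rw [← this]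
    exact Finset.sum_congr rfl fun j _ => by ring
  have hid : (k + 1) * δ * ((K ^ (k + 1) *ᵥ f) x - (K ^ k *ᵥ f) x) =
      ∑ j ∈ Finset.range (k + 1 + 1), b j * (j - (k + 1) * p) * a j := by
    have := congrArg (aeval Y) (derivative_bernstein_identity p k)
    simp only [hp1, ← smul_eq_C_mul] at this
    simp only [map_smul, map_mul, map_pow, map_add, map_sub, map_sum, aeval_C, aeval_X, map_one,
      Algebra.algebraMap_eq_smul_one, mul_smul_comm] at this
    rw [hKY] at this
    have hp' : p • (Y - 1) = K - 1 := by
      rw [← hKY, smul_sub, hp]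
      module
    rw [← mul_smul_comm p, hp', mul_sub, mul_one, ← pow_succ] at this
    have := congrArg (fun B : Matrix ι ι ℝ => (B *ᵥ f) x) this
    simp only [Matrix.smul_mulVec, Matrix.sub_mulVec, Matrix.sum_mulVec, Pi.smul_apply,
      Pi.sub_apply, Finset.sum_apply, smul_eq_mul] at this
    exact this
  have hcs : (∑ j ∈ Finset.range (k + 1 + 1), b j * (j - (k + 1) * p) * a j) ^ 2 ≤
      (k + 1) * p * δ := by
    have hle : ∀ j, b j * a j ^ 2 ≤ b j := fun j =>
      mul_le_of_le_one_right (hb0 j) (pow_le_one₀ (ha j x).1 (ha j x).2)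
    calc _ ≤ (∑ j ∈ Finset.range (k + 1 + 1), b j * (j - (k + 1) * p) ^ 2) *
          ∑ j ∈ Finset.range (k + 1 + 1), b j * a j ^ 2 :=
        Finset.sum_sq_le_sum_mul_sum_of_sq_le_mul _
          (fun j _ => mul_nonneg (hb0 j) (sq_nonneg _))
          (fun j _ => mul_nonneg (hb0 j) (sq_nonneg _)) fun j _ => le_of_eq (by ring)
      _ ≤ (k + 1) * p * δ * 1 := by
        rw [hb2]
        refine mul_le_mul_of_nonneg_left ?_ (by positivity)
        rw [← hb1]
        exact Finset.sum_le_sum fun j _ => hle j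
      _ = _ := mul_one _
  rw [← hid] at hcs
  have hpos : (0 : ℝ) < (k + 1) * δ := by positivity
  refine le_of_mul_le_mul_left ?_ hpos
  calc _ = ((k + 1) * δ * ((K ^ (k + 1) *ᵥ f) x - (K ^ k *ᵥ f) x)) ^ 2 := by ring
    _ ≤ (k + 1) * δ * p := by linarith
    _ ≤ (k + 1) * δ * 1 := mul_le_mul_of_nonneg_left (by linarith) hpos.le

namespace BDChain

variable {n : ℕ} (c : BDChain n)

lemma K_pow_row_sum (m : ℕ) (x : Fin (n + 1)) : ∑ y, (c.K ^ m) x y = 1 := by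
  have : c.K ^ m *ᵥ (fun _ => 1) = fun _ => (1 : ℝ) := by
    induction m with
    | zero => simp
    | succ m ih =>
      rw [pow_succ_mulVec, ih]
      funext x
      simp [Matrix.mulVec, dotProduct, c.K_rowSum]
  have := congrFun this x
  simpa [Matrix.mulVec, dotProduct] using this

lemma le_dTVMax (x : Fin (n + 1)) (m : ℕ) (A : Finset (Fin (n + 1))) :
    ∑ y ∈ A, (c.K ^ m) x y - ∑ y ∈ A, c.pi y ≤ c.dTVMax m :=
  (le_ciSup (f := fun A : Finset (Fin (n + 1)) => ∑ y ∈ A, (c.K ^ m) x y - ∑ y ∈ A, c.pi y)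
    (Set.finite_range _).bddAbove A).trans
    (le_ciSup (f := fun x => c.dTV x m) (Set.finite_range _).bddAbove x)

lemma sum_indicator (w : Fin (n + 1) → ℝ) (A : Finset (Fin (n + 1))) :
    ∑ y, w y * (if y ∈ A then 1 else 0) = ∑ y ∈ A, w y := by
  simp

lemma dTVMax_le {m : ℕ} {b : ℝ} (h : ∀ f : Fin (n + 1) → ℝ, (∀ x, 0 ≤ f x) → (∀ x, f x ≤ 1) →
    ∀ x, (c.K ^ m *ᵥ f) x - ∑ y, c.pi y * f y ≤ b) : c.dTVMax m ≤ b := by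
  refine ciSup_le fun x => ciSup_le fun A => ?_
  have := h (fun y => if y ∈ A then 1 else 0) (fun y => by split_ifs <;> norm_num)
    (fun y => by split_ifs <;> norm_num) x
  rwa [sum_indicator, Matrix.mulVec, dotProduct, sum_indicator] at this

lemma abs_pow_mulVec_sub_le (f : Fin (n + 1) → ℝ) {b : ℝ} (hf : ∀ y, |f y| ≤ b) (m : ℕ)
    (x : Fin (n + 1)) :
    |(c.K ^ m *ᵥ f) x - ∑ y, c.pi y * f y| ≤ 2 * b * c.dTVMax m := by
  have hb : 0 ≤ b := (abs_nonneg _).trans (hf 0)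
  set u : Fin (n + 1) → ℝ := fun y => (c.K ^ m) x y - c.pi y with hu
  have hu0 : ∑ y, u y = 0 := by
    simp only [hu, Finset.sum_sub_distrib, K_pow_row_sum, c.pi_sum, sub_self]
  set A : Finset (Fin (n + 1)) := Finset.univ.filter fun y => 0 ≤ u y with hA
  have hsum : ∑ y, |u y| = 2 * ∑ y ∈ A, u y := by
    have : ∀ y, |u y| = 2 * (if 0 ≤ u y then u y else 0) - u y := fun y => by
      split_ifs with h
      · rw [abs_of_nonneg h]; ring
      · rw [abs_of_neg (not_le.1 h)]; ring
    rw [Finset.sum_congr rfl fun y _ => this y, Finset.sum_sub_distrib, hu0, ← Finset.mul_sum,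
      hA, Finset.sum_filter, sub_zero]
  have h1 : (c.K ^ m *ᵥ f) x - ∑ y, c.pi y * f y = ∑ y, u y * f y := by
    rw [Matrix.mulVec, dotProduct, ← Finset.sum_sub_distrib]
    exact Finset.sum_congr rfl fun y _ => (sub_mul _ _ _).symm
  rw [h1]
  calc _ ≤ ∑ y, |u y * f y| := Finset.abs_sum_le_sum_abs _ _
    _ ≤ ∑ y, b * |u y| := Finset.sum_le_sum fun y _ => by
        rw [abs_mul, mul_comm]
        exact mul_le_mul_of_nonneg_right (hf y) (abs_nonneg _)
    _ = 2 * b * (∑ y ∈ A, (c.K ^ m) x y - ∑ y ∈ A, c.pi y) := by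
        rw [← Finset.mul_sum, hsum, ← Finset.sum_sub_distrib]; ring
    _ ≤ _ := mul_le_mul_of_nonneg_left (c.le_dTVMax x m A) (by positivity)

lemma abs_one_sub_pow_le {l : ℝ} (hl : l ∈ eigSet (1 - c.K)) (hl0 : l ≠ 0) (m : ℕ) :
    |1 - l| ^ m ≤ 2 * c.dTVMax m := by
  obtain ⟨v, hv0, hv⟩ := hl
  have hK : c.K *ᵥ v = (1 - l) • v := by
    rw [Matrix.sub_mulVec, Matrix.one_mulVec] at hv
    rw [sub_smul, one_smul, ← hv, sub_sub_cancel]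
  have hKm : c.K ^ m *ᵥ v = (1 - l) ^ m • v := by
    induction m with
    | zero => simp
    | succ m ih => rw [pow_succ_mulVec, ih, Matrix.mulVec_smul, hK, smul_smul, pow_succ]
  have hpi : ∑ y, c.pi y * v y = 0 := by
    have h1 := c.sum_pi_mul_sum_K v
    have h2 : ∀ x, ∑ y, c.K x y * v y = (1 - l) * v x := fun x => congrFun hK x
    simp only [h2, mul_left_comm _ (1 - l), ← Finset.mul_sum] at h1
    have h3 : l * ∑ y, c.pi y * v y = 0 := by linarith
    exact (mul_eq_zero.1 h3).resolve_left hl0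
  obtain ⟨x, -, hx⟩ := Finset.exists_max_image Finset.univ (fun x => |v x|) ⟨0, Finset.mem_univ _⟩
  have hxpos : 0 < |v x| := by
    by_contra! h
    refine hv0 (funext fun y => abs_nonpos_iff.1 ((hx y (Finset.mem_univ _)).trans h))
  have := c.abs_pow_mulVec_sub_le v (fun y => hx y (Finset.mem_univ _)) m x
  rw [hKm, hpi, sub_zero, Pi.smul_apply, smul_eq_mul, abs_mul, abs_pow] at this
  refine le_of_mul_le_mul_right ?_ hxpos
  linarith

end BDChain

namespace BDChain

variable {n : ℕ}

/-- The probability that two independent copies of the chain, started from `x` and `z`, satisfy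
`X_s < Z_s` for all `s ≤ t`. -/
def noCross (c : BDChain n) : ℕ → Fin (n + 1) → Fin (n + 1) → ℝ
  | 0, x, z => if x < z then 1 else 0
  | t + 1, x, z => if x < z then ∑ x', c.K x x' * ∑ z', c.K z z' * c.noCross t x' z' else 0

variable (c : BDChain n)

lemma sum_mul_sum_mul_comm {ι : Type*} [Fintype ι] (a b : ι → ℝ) (S : ι → ι → ℝ) :
    ∑ z, a z * ∑ x, b x * S z x = ∑ x, b x * ∑ z, a z * S z x := by
  simp only [Finset.mul_sum]
  rw [Finset.sum_comm]
  exact Finset.sum_congr rfl fun x _ => Finset.sum_congr rfl fun z _ => mul_left_comm _ _ _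

lemma noCross_nonneg (t : ℕ) (x z : Fin (n + 1)) : 0 ≤ c.noCross t x z := by
  induction t generalizing x z with
  | zero => rw [noCross]; split_ifs <;> norm_num
  | succ t ih =>
    rw [noCross]
    split_ifs
    · exact Finset.sum_nonneg fun x' _ => mul_nonneg (c.K_nonneg _ _) <|
        Finset.sum_nonneg fun z' _ => mul_nonneg (c.K_nonneg _ _) (ih _ _)
    · exact le_rfl

lemma noCross_le (t : ℕ) (x z : Fin (n + 1)) : c.noCross t x z ≤ if x < z then 1 else 0 := by
  induction t generalizing x z with
  | zero => exact le_rfl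
  | succ t ih =>
    rw [noCross]
    split_ifs
    · refine c.sum_K_mul_le x fun x' => c.sum_K_mul_le z fun z' => (ih _ _).trans ?_
      split_ifs <;> norm_num
    · exact le_rfl

lemma sum_K_mul_mono (x : Fin (n + 1)) {g h : Fin (n + 1) → ℝ}
    (hgh : ∀ y, c.K x y ≠ 0 → g y ≤ h y) : ∑ y, c.K x y * g y ≤ ∑ y, c.K x y * h y :=
  Finset.sum_le_sum fun y _ => by
    rcases eq_or_ne (c.K x y) 0 with h0 | h0
    · rw [h0, zero_mul, zero_mul]
    · exact mul_le_mul_of_nonneg_left (hgh y h0) (c.K_nonneg _ _)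

lemma abs_sub_sum_K_mul_le (x : Fin (n + 1)) (a : ℝ) (g : Fin (n + 1) → ℝ) :
    |a - ∑ y, c.K x y * g y| ≤ ∑ y, c.K x y * |a - g y| := by
  have : a - ∑ y, c.K x y * g y = ∑ y, c.K x y * (a - g y) := by
    simp only [mul_sub, Finset.sum_sub_distrib, ← Finset.sum_mul, c.K_rowSum, one_mul]
  rw [this]
  refine (Finset.abs_sum_le_sum_abs _ _).trans (Finset.sum_le_sum fun y _ => ?_)
  rw [abs_mul, abs_of_nonneg (c.K_nonneg x y)]

/-- Two copies can only exchange their order by meeting, up to a time shift by one step. -/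
lemma abs_sub_le_noCross {φ : ℕ → Fin (n + 1) → ℝ} (hφ : ∀ m x, φ (m + 1) x = ∑ y, c.K x y * φ m y)
    {k : ℕ} (h0 : ∀ x, 0 ≤ φ k x) (h1 : ∀ x, φ k x ≤ 1) {η : ℝ} (hη0 : 0 ≤ η)
    (hη : ∀ m, k ≤ m → ∀ x, |φ (m + 1) x - φ m x| ≤ η) (t : ℕ) {x z : Fin (n + 1)} (hxz : x ≤ z) :
    |φ (k + t) x - φ (k + t) z| ≤ c.noCross t x z + η := by
  induction t generalizing x z with
  | zero =>
    rcases eq_or_lt_of_le hxz with rfl | h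
    · rw [sub_self, abs_zero]
      exact add_nonneg (c.noCross_nonneg _ _ _) hη0
    · rw [noCross, if_pos h, add_zero, abs_le]
      constructor <;> linarith [h0 x, h1 x, h0 z, h1 z]
  | succ t ih =>
    rcases eq_or_lt_of_le hxz with rfl | h
    · rw [sub_self, abs_zero]
      exact add_nonneg (c.noCross_nonneg _ _ _) hη0
    rw [noCross, if_pos h, ← add_assoc, hφ _ x, abs_sub_comm, ← c.sum_K_mul_add]
    refine (c.abs_sub_sum_K_mul_le _ _ _).trans (c.sum_K_mul_mono x fun x' hx' => ?_)
    have hx'z : (x' : ℕ) ≤ z := by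
      by_contra! hlt
      exact hx' (c.K_eq_zero (Or.inl (by have : (x : ℕ) < z := h; omega)))
    rcases eq_or_lt_of_le hx'z with he | hlt
    · rw [Fin.ext he]
      refine (hη _ (Nat.le_add_right k t) z).trans (le_add_of_nonneg_left ?_)
      exact Finset.sum_nonneg fun z' _ => mul_nonneg (c.K_nonneg _ _) (c.noCross_nonneg _ _ _)
    · rw [hφ, abs_sub_comm, ← c.sum_K_mul_add]
      refine (c.abs_sub_sum_K_mul_le _ _ _).trans (c.sum_K_mul_mono z fun z' hz' => ih ?_)
      by_contra! hlt'
      exact hz' (c.K_eq_zero (Or.inr (by have : (z' : ℕ) < x' := hlt'; omega)))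

lemma sum_pi_mul_noCross_le (Q t : ℕ) (x : Fin (n + 1)) :
    ∑ z, c.pi z * c.noCross t x z ≤ c.upSurv Q t x + c.cumHigh (Q + 1) := by
  have hge : ∀ t (x : Fin (n + 1)), Q ≤ (x : ℕ) →
      ∑ z, c.pi z * c.noCross t x z ≤ c.upSurv Q t x + c.cumHigh (Q + 1) := fun t x hx => by
    rw [c.upSurv_of_le t hx, zero_add, cumHigh]
    refine Finset.sum_le_sum fun z _ => ?_
    have hp := (c.pi_pos z).le
    have hle := c.noCross_le t x z
    by_cases hz : Q + 1 ≤ (z : ℕ)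
    · rw [if_pos hz]
      exact mul_le_of_le_one_right hp (hle.trans (by split_ifs <;> norm_num))
    · rw [if_neg (by rw [Fin.lt_def]; omega)] at hle
      rw [if_neg hz]
      exact mul_nonpos_of_nonneg_of_nonpos hp hle
  induction t generalizing x with
  | zero =>
    rcases le_or_gt Q (x : ℕ) with hx | hx
    · exact hge 0 x hx
    · rw [upSurv_zero, if_pos hx]
      refine le_add_of_le_of_nonneg ?_ (c.cumHigh_nonneg _)
      rw [← c.pi_sum]
      exact Finset.sum_le_sum fun z _ => mul_le_of_le_one_right (c.pi_pos z).le
        ((c.noCross_le 0 x z).trans (by split_ifs <;> norm_num))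
  | succ t ih =>
    rcases le_or_gt Q (x : ℕ) with hx | hx
    · exact hge (t + 1) x hx
    · rw [upSurv_succ, if_pos hx, ← c.sum_K_mul_add]
      calc ∑ z, c.pi z * c.noCross (t + 1) x z
          ≤ ∑ z, c.pi z * ∑ x', c.K x x' * ∑ z', c.K z z' * c.noCross t x' z' := by
            refine Finset.sum_le_sum fun z _ => mul_le_mul_of_nonneg_left ?_ (c.pi_pos z).le
            rw [noCross]
            split_ifs
            · exact le_rfl
            · exact Finset.sum_nonneg fun x' _ => mul_nonneg (c.K_nonneg _ _) <|
                Finset.sum_nonneg fun z' _ => mul_nonneg (c.K_nonneg _ _) (c.noCross_nonneg _ _ _)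
        _ = ∑ x', c.K x x' * ∑ z, c.pi z * ∑ z', c.K z z' * c.noCross t x' z' := by
            exact sum_mul_sum_mul_comm _ _ fun z x' => ∑ z', c.K z z' * c.noCross t x' z'
        _ = ∑ x', c.K x x' * ∑ z, c.pi z * c.noCross t x' z := by
            simp only [c.sum_pi_mul_sum_K]
        _ ≤ _ := c.sum_K_mul_mono x fun x' _ => ih x'

lemma upSurv_add_le {M Q s : ℕ} (hMQ : M ≤ Q) {e : ℝ} (he0 : 0 ≤ e)
    (he : ∀ y : Fin (n + 1), M ≤ (y : ℕ) → c.upSurv Q s y ≤ e) (t : ℕ) (x : Fin (n + 1)) :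
    c.upSurv Q (t + s) x ≤ c.upSurv M t x + e := by
  rcases le_or_gt M (x : ℕ) with hx | hx
  · rw [c.upSurv_of_le t hx, zero_add]
    exact (c.upSurv_anti Q x (Nat.le_add_left s t)).trans (he x hx)
  induction t generalizing x with
  | zero =>
    rw [upSurv_zero, if_pos hx]
    exact le_add_of_le_of_nonneg (c.upSurv_le_one _ _ _) he0
  | succ t ih =>
    rw [add_right_comm, upSurv_succ, if_pos (by omega), upSurv_succ, if_pos hx,
      ← c.sum_K_mul_add]
    refine c.sum_K_mul_mono x fun y _ => ?_
    rcases le_or_gt M (y : ℕ) with hy | hy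
    · rw [c.upSurv_of_le t hy, zero_add]
      exact (c.upSurv_anti Q y (Nat.le_add_left s t)).trans (he y hy)
    · exact ih y hy

lemma mulVec_pow_mem_Icc {f : Fin (n + 1) → ℝ} (h0 : ∀ x, 0 ≤ f x) (h1 : ∀ x, f x ≤ 1) (m : ℕ)
    (x : Fin (n + 1)) : (c.K ^ m *ᵥ f) x ∈ Set.Icc (0 : ℝ) 1 := by
  induction m generalizing x with
  | zero => simp [h0, h1]
  | succ m ih =>
    rw [pow_succ_mulVec]
    exact ⟨Finset.sum_nonneg (s := Finset.univ)
        (f := fun y => c.K x y * (c.K ^ m *ᵥ f) y) fun y _ =>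
      mul_nonneg (c.K_nonneg x y) (ih y).1, c.sum_K_mul_le x fun y => (ih y).2⟩

lemma sum_pi_mul_pow_mulVec (f : Fin (n + 1) → ℝ) (m : ℕ) :
    ∑ x, c.pi x * (c.K ^ m *ᵥ f) x = ∑ x, c.pi x * f x := by
  induction m with
  | zero => simp
  | succ m ih =>
    rw [pow_succ_mulVec, ← ih]
    exact c.sum_pi_mul_sum_K _

lemma dTVMax_le_of_crossing {δ : ℝ} (hδ0 : 0 < δ) (hδ1 : δ < 1) (hδ : ∀ x, δ ≤ c.K x x)
    {k t Q Q' : ℕ} {η b b' : ℝ} (hη0 : 0 ≤ η) (hη : 1 ≤ (k + 1) * δ * η ^ 2)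
    (hb : ∀ x, c.upSurv Q t x + c.cumHigh (Q + 1) ≤ b)
    (hb' : ∀ x, c.rev.upSurv Q' t x + c.rev.cumHigh (Q' + 1) ≤ b') :
    c.dTVMax (k + t) ≤ η + b + b' := by
  refine c.dTVMax_le fun f hf0 hf1 x => ?_
  set φ : ℕ → Fin (n + 1) → ℝ := fun m => c.K ^ m *ᵥ f with hφ
  have hφs : ∀ m x, φ (m + 1) x = ∑ y, c.K x y * φ m y := fun m x => by
    simp only [hφ, pow_succ_mulVec]; rfl
  have hIcc := c.mulVec_pow_mem_Icc hf0 hf1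
  have hsm : ∀ m, k ≤ m → ∀ x, |φ (m + 1) x - φ m x| ≤ η := fun m hm x => by
    have h := mul_sq_pow_succ_mulVec_sub_le c.K_nonneg c.K_rowSum hδ0 hδ1 hδ hf0 hf1 m x
    refine abs_le_of_sq_le_sq ?_ hη0
    have hmk : (k : ℝ) ≤ m := by exact_mod_cast hm
    have h2 : (k + 1 : ℝ) * δ * ((c.K ^ (m + 1) *ᵥ f) x - (c.K ^ m *ᵥ f) x) ^ 2 ≤
        (k + 1) * δ * η ^ 2 := by
      refine le_trans ?_ (h.trans hη)
      gcongr
    exact le_of_mul_le_mul_left h2 (by positivity)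
  have hpair : ∀ z, φ (k + t) x - φ (k + t) z ≤
      c.noCross t x z + c.rev.noCross t x.rev z.rev + η := fun z => by
    have n1 := c.noCross_nonneg t x z
    have n2 := c.rev.noCross_nonneg t x.rev z.rev
    rcases le_total x z with h | h
    · have := c.abs_sub_le_noCross hφs (fun y => (hIcc k y).1) (fun y => (hIcc k y).2) hη0 hsm t h
      linarith [le_abs_self (φ (k + t) x - φ (k + t) z)]
    · have := c.rev.abs_sub_le_noCross (φ := fun m y => φ m y.rev) (fun m y => by
          rw [hφs, ← Equiv.sum_comp Fin.revPerm]; simp) (fun y => (hIcc k y.rev).1)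
        (fun y => (hIcc k y.rev).2) hη0 (fun m hm y => hsm m hm y.rev) t (Fin.rev_le_rev.2 h)
      simp only [Fin.rev_rev] at this
      linarith [le_abs_self (φ (k + t) x - φ (k + t) z)]
  have hrev : ∑ z, c.pi z * c.rev.noCross t x.rev z.rev =
      ∑ z, c.rev.pi z * c.rev.noCross t x.rev z := by
    rw [← Equiv.sum_comp Fin.revPerm]; simp
  have hx : φ (k + t) x = ∑ z, c.pi z * φ (k + t) x := by
    rw [← Finset.sum_mul, c.pi_sum, one_mul]
  calc (c.K ^ (k + t) *ᵥ f) x - ∑ y, c.pi y * f y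
      = ∑ z, c.pi z * (φ (k + t) x - φ (k + t) z) := by
        rw [← c.sum_pi_mul_pow_mulVec f (k + t)]
        simp only [mul_sub, Finset.sum_sub_distrib]
        rw [← hx]
    _ ≤ ∑ z, c.pi z * (c.noCross t x z + c.rev.noCross t x.rev z.rev + η) :=
        Finset.sum_le_sum fun z _ => mul_le_mul_of_nonneg_left (hpair z) (c.pi_pos z).le
    _ = ∑ z, c.pi z * c.noCross t x z + ∑ z, c.rev.pi z * c.rev.noCross t x.rev z + η := by
        simp only [mul_add, Finset.sum_add_distrib]
        rw [hrev, ← Finset.sum_mul, c.pi_sum, one_mul]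
    _ ≤ η + b + b' := by
        linarith [(c.sum_pi_mul_noCross_le Q t x).trans (hb x),
          (c.rev.sum_pi_mul_noCross_le Q' t x.rev).trans (hb' x.rev)]

end BDChain

namespace BDChain

variable {n : ℕ} (c : BDChain n)

lemma exists_upSurv_add_cumHigh_le {δ : ℝ} (hδ0 : 0 < δ) (hδ : ∀ x, δ ≤ c.K x x) {M : ℕ}
    (hM : M ≤ n) {e : ℝ} (he0 : 0 < e) (he1 : e < 1) (heM : e < c.cumHigh M) {θ β : ℝ}
    (hθ : c.upMean M 0 ≤ θ) (hv : c.upVar M 0 ≤ β ^ 2) (hv' : c.rev.upVar (n - M) 0 ≤ β ^ 2)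
    {s t : ℕ} (hs0 : 0 < s) (hs : 2 * β ^ 2 ≤ δ * (e * (s * e)) ^ 2) (ht0 : θ < t)
    (ht : β ^ 2 ≤ e * (t - θ) ^ 2) :
    ∃ Q, ∀ x, c.upSurv Q (t + s) x + c.cumHigh (Q + 1) ≤ 3 * e := by
  classical
  have hex : ∃ k, c.cumHigh (k + 1) ≤ e := ⟨n, by
    refine le_trans (le_of_eq ?_) he0.le
    exact Finset.sum_eq_zero fun x _ => if_neg (by have := x.isLt; omega)⟩
  set Q := Nat.find hex with hQ
  have hQe : c.cumHigh (Q + 1) ≤ e := Nat.find_spec hex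
  have hanti : ∀ {i j : ℕ}, i ≤ j → c.cumHigh j ≤ c.cumHigh i := fun {i j} hij => by
    refine Finset.sum_le_sum fun x _ => ?_
    have := (c.pi_pos x).le
    split_ifs with h1 h2 h2
    · exact le_rfl
    · omega
    · exact this
    · exact le_rfl
  have hMQ : M ≤ Q := by
    by_contra! h
    exact absurd (heM.trans_le (hanti h)) (not_lt.2 hQe)
  have hQn : Q ≤ n := Nat.find_min' hex (by
    refine le_trans (le_of_eq ?_) he0.le
    exact Finset.sum_eq_zero fun x _ => if_neg (by have := x.isLt; omega))
  have hQgt : e < c.cumHigh Q := by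
    rcases Nat.eq_zero_or_pos Q with h0 | h0
    · rw [h0, cumHigh]
      simpa [c.pi_sum] using he1
    · have := Nat.find_min hex (m := Q - 1) (by omega)
      rwa [Nat.sub_add_cancel h0, not_le] at this
  have hres : c.resist M Q ≤ s * e := by
    have h1 := c.rev.half_mul_sq_le_upVar hδ0.le (fun x => hδ x.rev) (n - Q) (i := n - M)
      (Nat.sub_le _ _)
    rw [c.rev_cum hQn, c.rev_resist hQn] at h1
    have h2 : (e * c.resist M Q) ^ 2 ≤ (c.cumHigh Q * c.resist M Q) ^ 2 :=
      pow_le_pow_left₀ (mul_nonneg he0.le (c.resist_nonneg _ _))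
        (mul_le_mul_of_nonneg_right hQgt.le (c.resist_nonneg _ _)) 2
    have h3 : δ * (e * c.resist M Q) ^ 2 ≤ δ * (e * (s * e)) ^ 2 := by
      have := mul_le_mul_of_nonneg_left h2 hδ0.le
      linarith
    have h4 := abs_le_of_sq_le_sq (le_of_mul_le_mul_left h3 hδ0) (by positivity)
    exact le_of_mul_le_mul_left ((le_abs_self _).trans h4) he0
  have hsurv : ∀ y : Fin (n + 1), M ≤ (y : ℕ) → c.upSurv Q s y ≤ e := fun y hy => by
    rcases le_or_gt Q (y : ℕ) with h | h
    · rw [c.upSurv_of_le s h]; exact he0.le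
    · have h1 := c.upSurv_mul_le hQn s y h.le (fun k _ => c.upMean_nonneg Q k) 0 le_rfl
      have h2 := c.upMean_le_resist (i := Q) hy
      have hs' : (0 : ℝ) < s := by exact_mod_cast hs0
      refine le_of_mul_le_mul_right ?_ hs'
      linarith
  have htM : ∀ x, c.upSurv M t x ≤ e := fun x => by
    rcases le_or_gt M (x : ℕ) with h | h
    · rw [c.upSurv_of_le t h]; exact he0.le
    · have hmx : c.upMean M x ≤ θ := (c.upMean_le_upMean x M).trans hθ
      have h1 := c.upSurv_mul_sq_le hM t x h.le (fun k _ => c.upVar_nonneg M k)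
        (fun k _ => c.upMean_nonneg M k) (-c.upMean M x) (by linarith)
      have h2 : c.upVar M x ≤ β ^ 2 := (c.upVar_mono le_rfl).trans hv
      have h3 : (t - θ) ^ 2 ≤ (t + -c.upMean M x) ^ 2 :=
        pow_le_pow_left₀ (by linarith) (by linarith) 2
      have h4 := mul_le_mul_of_nonneg_left h3 he0.le
      have hpos : 0 < (t + -c.upMean M x) ^ 2 := pow_pos (by linarith) 2
      refine le_of_mul_le_mul_right ?_ hpos
      have : (c.upMean M x + -c.upMean M x) ^ 2 = 0 := by ring
      linarith
  refine ⟨Q, fun x => ?_⟩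
  linarith [c.upSurv_add_le hMQ he0.le hsurv t x, htM x]

lemma upSurv_le_pow_mulVec (i m : ℕ) (x : Fin (n + 1)) :
    c.upSurv i m x ≤ (c.K ^ m *ᵥ fun y => if (y : ℕ) < i then 1 else 0) x := by
  induction m generalizing x with
  | zero => rw [upSurv_zero, pow_zero, Matrix.one_mulVec]
  | succ m ih =>
    rw [upSurv_succ, pow_succ_mulVec]
    refine le_trans ?_ (c.sum_K_mul_mono x fun y _ => ih y)
    split_ifs
    · exact le_rfl
    · exact Finset.sum_nonneg fun y _ => mul_nonneg (c.K_nonneg _ _) (c.upSurv_nonneg _ _ _)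

lemma one_sub_le_dTVMax {δ : ℝ} (hδ0 : 0 < δ) (hδ : ∀ x, δ ≤ c.K x x) {M : ℕ} (hM : M ≤ n)
    {e : ℝ} (he0 : 0 < e) (heM : e < c.cum M) {β : ℝ} (hv : c.upVar M 0 ≤ β ^ 2) {r : ℝ}
    (hr0 : 0 ≤ r) (hr : 2 * β ^ 2 ≤ δ * (e * r) ^ 2) {m : ℕ} (hm0 : m < c.upMean M 0 - r)
    (hm : β ^ 2 ≤ e * (c.upMean M 0 - r - m) ^ 2) : 1 - 2 * e ≤ c.dTVMax m := by
  classical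
  have hex : ∃ k, e < c.cum k := ⟨M, heM⟩
  set Q := Nat.find hex with hQ
  have hQe : e < c.cum Q := Nat.find_spec hex
  have hQM : Q ≤ M := Nat.find_min' hex heM
  have hres : c.resist Q M ≤ r := by
    have h1 := c.half_mul_sq_le_upVar hδ0.le hδ Q hM
    have h2 : (e * c.resist Q M) ^ 2 ≤ (c.cum Q * c.resist Q M) ^ 2 :=
      pow_le_pow_left₀ (mul_nonneg he0.le (c.resist_nonneg _ _))
        (mul_le_mul_of_nonneg_right hQe.le (c.resist_nonneg _ _)) 2
    have h3 : δ * (e * c.resist Q M) ^ 2 ≤ δ * (e * r) ^ 2 := by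
      have := mul_le_mul_of_nonneg_left h2 hδ0.le
      linarith
    have h4 := abs_le_of_sq_le_sq (le_of_mul_le_mul_left h3 hδ0) (by positivity)
    exact le_of_mul_le_mul_left ((le_abs_self _).trans h4) he0
  have hmean : c.upMean M 0 - r ≤ c.upMean Q 0 := by
    linarith [c.upMean_add hQM, c.upMean_le_resist (i := M) (le_refl Q)]
  have hQ0 : 0 < Q := by
    by_contra! h
    rw [Nat.le_zero.1 h, show c.upMean 0 0 = 0 by simp [upMean]] at hmean
    linarith [Nat.cast_nonneg (α := ℝ) m]
  have hlow : c.cum (Q - 1) ≤ e := not_lt.1 (Nat.find_min hex (m := Q - 1) (by omega))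
  have hcheb : 1 - c.upSurv Q m 0 ≤ e := by
    have h1 := c.one_sub_upSurv_mul_sq_le (hQM.trans hM) m 0 (Nat.zero_le _)
      (fun k _ => c.upVar_nonneg Q k) (-c.upMean Q 0) (by linarith)
    simp only [Fin.val_zero] at h1
    have h2 : c.upVar Q 0 ≤ β ^ 2 := (c.upVar_mono hQM).trans hv
    have h3 : (c.upMean M 0 - r - m) ^ 2 ≤ (c.upMean Q 0 - m) ^ 2 :=
      pow_le_pow_left₀ (by linarith) (by linarith) 2
    have h4 := mul_le_mul_of_nonneg_left h3 he0.le
    have h5 : (m + -c.upMean Q 0) ^ 2 = (c.upMean Q 0 - m) ^ 2 := by ring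
    have hpos : 0 < (c.upMean Q 0 - m) ^ 2 := pow_pos (by linarith) 2
    rw [h5] at h1
    refine le_of_mul_le_mul_right ?_ hpos
    have : (c.upMean Q 0 + -c.upMean Q 0) ^ 2 = 0 := by ring
    linarith
  have hd := c.le_dTVMax 0 m (Finset.univ.filter fun y => (y : ℕ) < Q)
  have e1 : ∑ y ∈ Finset.univ.filter (fun y : Fin (n + 1) => (y : ℕ) < Q), (c.K ^ m) 0 y =
      (c.K ^ m *ᵥ fun y => if (y : ℕ) < Q then 1 else 0) 0 := by
    simp [Matrix.mulVec, dotProduct, Finset.sum_filter]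
  have e2 : ∑ y ∈ Finset.univ.filter (fun y : Fin (n + 1) => (y : ℕ) < Q), c.pi y =
      c.cum (Q - 1) := by
    rw [Finset.sum_filter, cum]
    refine Finset.sum_congr rfl fun y _ => ?_
    congr 1
    exact propext ⟨fun h => by omega, fun h => by omega⟩
  rw [e1, e2] at hd
  linarith [c.upSurv_le_pow_mulVec Q m 0]

lemma rev_K_pow (m : ℕ) (x y : Fin (n + 1)) : (c.rev.K ^ m) x y = (c.K ^ m) x.rev y.rev := by
  induction m generalizing x with
  | zero => simp [Matrix.one_apply]
  | succ m ih =>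
    rw [pow_succ', pow_succ', Matrix.mul_apply, Matrix.mul_apply, ← Equiv.sum_comp Fin.revPerm]
    exact Finset.sum_congr rfl fun z _ => by simp [ih]

lemma rev_dTVMax_le (m : ℕ) : c.rev.dTVMax m ≤ c.dTVMax m := by
  refine ciSup_le fun x => ciSup_le fun A => ?_
  have := c.le_dTVMax x.rev m (A.map Fin.revPerm.toEmbedding)
  simpa [rev_K_pow] using this

lemma Poincare.rev {c : BDChain n} {l : ℝ} (h : c.Poincare l) : c.rev.Poincare l := by
  intro f
  have := h fun x => f x.rev
  rw [← Equiv.sum_comp Fin.revPerm, ← Equiv.sum_comp Fin.revPerm (fun y => c.pi y * _),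
    ← Equiv.sum_comp Fin.revPerm fun x => c.pi x * (f x.rev * _)] at this
  simp only [Fin.revPerm_apply, Fin.rev_rev] at this
  have hK : ∀ x : Fin (n + 1), ∑ y, c.K x.rev y * f y.rev = ∑ y, c.rev.K x y * f y := fun x => by
    rw [← Equiv.sum_comp Fin.revPerm]; simp
  simpa only [hK, rev_pi] using this

end BDChain

namespace BDChain

variable {n : ℕ}

/-- `θ` and `β` are the maximal mean and standard deviation of the hitting times of `M` from the
two ends of a chain whose holding probabilities are at least `δ`, where both sides of `M` have
stationary mass at least `κ`. -/
structure HittingScale (c : BDChain n) (M : ℕ) (δ κ θ β : ℝ) : Prop where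
  pos : 0 < n
  le : M ≤ n
  lazy : ∀ x, δ ≤ c.K x x
  low : κ ≤ c.cum M
  high : κ ≤ c.cumHigh M
  mean_eq : θ = max (c.upMean M 0) (c.rev.upMean (n - M) 0)
  nonneg : 0 ≤ β
  sq_eq : β ^ 2 = max (c.upVar M 0) (c.rev.upVar (n - M) 0)

namespace HittingScale

variable {c : BDChain n} {M : ℕ} {δ κ θ β : ℝ}

lemma rev (h : c.HittingScale M δ κ θ β) : c.rev.HittingScale (n - M) δ κ θ β where
  pos := h.pos
  le := Nat.sub_le _ _
  lazy x := h.lazy x.rev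
  low := by rw [c.rev_cum h.le]; exact h.high
  high := by
    rw [← c.rev.rev_cum (Nat.sub_le _ _), c.rev_rev, Nat.sub_sub_self h.le]
    exact h.low
  mean_eq := by rw [c.rev_rev, Nat.sub_sub_self h.le, max_comm]; exact h.mean_eq
  nonneg := h.nonneg
  sq_eq := by rw [c.rev_rev, Nat.sub_sub_self h.le, max_comm]; exact h.sq_eq

lemma upMean_le (h : c.HittingScale M δ κ θ β) : c.upMean M 0 ≤ θ := h.mean_eq ▸ le_max_left _ _

lemma upVar_le (h : c.HittingScale M δ κ θ β) : c.upVar M 0 ≤ β ^ 2 := h.sq_eq ▸ le_max_left _ _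

lemma theta_nonneg (h : c.HittingScale M δ κ θ β) : 0 ≤ θ := (c.upMean_nonneg M 0).trans h.upMean_le

lemma le_two_mul (h : c.HittingScale M δ κ θ β) : (n : ℝ) ≤ 2 * θ := by
  have h1 := c.le_upMean h.le
  have h2 := c.rev.le_upMean (Nat.sub_le n M)
  have h3 := h.upMean_le
  have h4 := h.rev.upMean_le
  rw [Nat.cast_sub h.le] at h2
  linarith

lemma half_le_sq (h : c.HittingScale M δ κ θ β) (hδ : 0 < δ) : δ / 2 ≤ β ^ 2 := by
  rcases Nat.eq_zero_or_pos M with h0 | h0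
  · exact (c.rev.half_le_upVar hδ.le h.rev.lazy (Nat.sub_le _ _)
      (by rw [h0]; exact h.pos)).trans h.rev.upVar_le
  · exact (c.half_le_upVar hδ.le h.lazy h.le h0).trans h.upVar_le

lemma beta_pos (h : c.HittingScale M δ κ θ β) (hδ : 0 < δ) : 0 < β :=
  lt_of_le_of_ne h.nonneg fun h0 => by
    have := h.half_le_sq hδ
    rw [← h0] at this
    linarith

lemma one_le_sqrt_mul (h : c.HittingScale M δ κ θ β) (hδ : 0 < δ) : 1 ≤ √(2 / δ) * β := by
  have h1 : 1 ≤ 2 / δ * β ^ 2 := by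
    have := mul_le_mul_of_nonneg_left (h.half_le_sq hδ) (show 0 ≤ 2 / δ by positivity)
    rwa [show 2 / δ * (δ / 2) = 1 by field_simp] at this
  rw [← Real.sqrt_sq h.nonneg, ← Real.sqrt_mul (by positivity)]
  exact Real.one_le_sqrt.2 h1

lemma sq_le (h : c.HittingScale M δ κ θ β) : β ^ 2 ≤ 2 * θ ^ 2 := by
  have key : ∀ {c : BDChain n} {M : ℕ}, c.HittingScale M δ κ θ β → c.upVar M 0 ≤ 2 * θ ^ 2 :=
    fun {c M} h => by
      refine (c.upVar_le fun k _ => c.cum_mul_resist_le k M).trans ?_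
      nlinarith [h.upMean_le, c.upMean_nonneg M 0]
  rw [h.sq_eq]
  exact max_le (key h) (key h.rev)

lemma mul_sq_le (h : c.HittingScale M δ κ θ β) (hκ : 0 < κ) {l : ℝ} (hl : 0 < l)
    (hP : c.Poincare l) : κ * l * β ^ 2 ≤ 4 * θ := by
  have key : ∀ {c : BDChain n} {M : ℕ}, c.HittingScale M δ κ θ β → c.Poincare l →
      κ * l * c.upVar M 0 ≤ 4 * θ := fun {c M} h hP => by
    have hB : ∀ k, k < M → c.cum k * c.resist k M ≤ 2 / (κ * l) := fun k hk => by
      have h1 := hP.mul_resist_le hl.le hk h.le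
      have h2 : l * (c.cum k * κ * c.resist k M) ≤ l * (c.cum k * c.cumHigh M * c.resist k M) := by
        have := c.resist_nonneg k M
        have := (c.cum_pos k).le
        have := h.high
        gcongr
      rw [le_div_iff₀ (by positivity)]
      linarith
    have h3 := mul_le_mul_of_nonneg_left (c.upVar_le hB) (show 0 ≤ κ * l by positivity)
    have h4 : κ * l * (2 * (2 / (κ * l)) * c.upMean M 0) = 4 * c.upMean M 0 := by
      field_simp
      ring
    linarith [h.upMean_le]
  rw [h.sq_eq]
  rcases max_choice (c.upVar M 0) (c.rev.upVar (n - M) 0) with h' | h' <;> rw [h']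
  · exact key h hP
  · exact key h.rev hP.rev

lemma lt_one (h : c.HittingScale M δ κ θ β) : δ < 1 := by
  have h1 := c.K_irred 0 h.pos
  have h2 : c.K 0 0 + c.K 0 ⟨1, by have := h.pos; omega⟩ ≤ 1 := by
    rw [← c.K_rowSum 0]
    exact Finset.add_le_sum (fun i _ => c.K_nonneg 0 i) (Finset.mem_univ _) (Finset.mem_univ _)
      (by simp [Fin.ext_iff])
  have h3 : 0 < c.K 0 ⟨1, by have := h.pos; omega⟩ := h1.1
  linarith [h.lazy 0]

end HittingScale

lemma exists_dTVMax_le {δ κ ε : ℝ} (hδ : 0 < δ) (hκ : 0 < κ) (hε : 0 < ε) :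
    ∃ C, 0 ≤ C ∧ ∀ {n : ℕ} {c : BDChain n} {M : ℕ} {θ β : ℝ}, c.HittingScale M δ κ θ β →
      ∀ m : ℕ, θ + C * β ≤ m → c.dTVMax m ≤ ε := by
  set e := min (ε / 7) (min (κ / 2) (1 / 2)) with he
  have he0 : 0 < e := by positivity
  have he7 : 7 * e ≤ ε := by have := min_le_left (ε / 7) (min (κ / 2) (1 / 2)); linarith
  have heκ : e < κ := by
    have := (min_le_right (ε / 7) _).trans (min_le_left (κ / 2) (1 / 2)); linarith
  have he1 : e < 1 := by
    have := (min_le_right (ε / 7) _).trans (min_le_right (κ / 2) (1 / 2)); linarith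
  obtain ⟨k, hk⟩ := exists_nat_ge (1 / (δ * e ^ 2))
  have hk' : 1 ≤ (k + 1 : ℝ) * δ * e ^ 2 := by
    rw [div_le_iff₀ (by positivity)] at hk
    have : 0 < δ * e ^ 2 := by positivity
    linarith
  set g := √(2 / δ) with hg
  have hg2 : δ * g ^ 2 = 2 := by
    rw [hg, Real.sq_sqrt (by positivity)]
    field_simp
  have hg0 : 0 ≤ g := Real.sqrt_nonneg _
  set w := √e with hw
  have hw0 : 0 < w := Real.sqrt_pos.2 he0
  have hw2 : w ^ 2 = e := Real.sq_sqrt he0.le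
  refine ⟨g / e ^ 2 + 1 / w + (k + 3) * g, by positivity, fun {n c M θ β} h m hm => ?_⟩
  have hβ0 := h.nonneg
  have hgβ : 1 ≤ g * β := h.one_le_sqrt_mul hδ
  set s := ⌈g * β / e ^ 2⌉₊ + 1 with hs
  have hs1 : g * β / e ^ 2 ≤ s := by
    rw [hs]; push_cast
    linarith [Nat.le_ceil (g * β / e ^ 2)]
  have hs2 : (s : ℝ) ≤ g * β / e ^ 2 + 2 := by
    rw [hs]; push_cast
    linarith [Nat.ceil_lt_add_one (show 0 ≤ g * β / e ^ 2 by positivity)]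
  have hm' : θ + g * β / e ^ 2 + β / w + (k + 3) ≤ m := by
    have h1 : (k + 3 : ℝ) * 1 ≤ (k + 3) * (g * β) :=
      mul_le_mul_of_nonneg_left hgβ (by positivity)
    have h2 : (g / e ^ 2 + 1 / w + (k + 3) * g) * β =
        g * β / e ^ 2 + β / w + (k + 3) * (g * β) := by ring
    linarith
  have hks : k + s ≤ m := by
    have hβw : 0 ≤ β / w := by positivity
    have : ((k + s : ℕ) : ℝ) ≤ m := by
      push_cast
      linarith [h.theta_nonneg]
    exact_mod_cast this
  obtain ⟨t, rfl⟩ : ∃ t, m = k + (t + s) := ⟨m - (k + s), by omega⟩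
  have ht0 : β / w + 1 ≤ t - θ := by
    push_cast at hm'
    linarith
  have hβw : 0 ≤ β / w := by positivity
  have ht : β ^ 2 ≤ e * (t - θ) ^ 2 := by
    have h1 : (β / w) ^ 2 ≤ (t - θ) ^ 2 := pow_le_pow_left₀ hβw (by linarith) 2
    have h2 := mul_le_mul_of_nonneg_left h1 he0.le
    rwa [div_pow, hw2, mul_div_cancel₀ _ he0.ne'] at h2
  have hs3 : 2 * β ^ 2 ≤ δ * (e * (s * e)) ^ 2 := by
    have h1 : g * β ≤ e * (s * e) := by
      rw [div_le_iff₀ (by positivity)] at hs1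
      linarith
    have h2 := mul_le_mul_of_nonneg_left (pow_le_pow_left₀ (by positivity) h1 2) hδ.le
    rwa [mul_pow, ← mul_assoc, hg2] at h2
  have key : ∀ {c : BDChain n} {M : ℕ}, c.HittingScale M δ κ θ β →
      ∃ Q, ∀ x, c.upSurv Q (t + s) x + c.cumHigh (Q + 1) ≤ 3 * e := fun {c M} h =>
    c.exists_upSurv_add_cumHigh_le hδ h.lazy h.le he0 he1 (heκ.trans_le h.high) h.upMean_le
      h.upVar_le h.rev.upVar_le (Nat.succ_pos _) hs3 (by linarith) ht
  obtain ⟨Q, hQ⟩ := key h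
  obtain ⟨Q', hQ'⟩ := key h.rev
  have := c.dTVMax_le_of_crossing hδ h.lt_one h.lazy he0.le hk' hQ hQ'
  linarith

lemma exists_lt_dTVMax {δ κ ε : ℝ} (hδ : 0 < δ) (hκ : 0 < κ) (hε : ε < 1) :
    ∃ C, 0 ≤ C ∧ ∀ {n : ℕ} {c : BDChain n} {M : ℕ} {θ β : ℝ}, c.HittingScale M δ κ θ β →
      ∀ m : ℕ, m ≤ θ - C * β → ε < c.dTVMax m := by
  set e := min ((1 - ε) / 3) (κ / 2) with he
  have hε' : 0 < 1 - ε := by linarith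
  have he0 : 0 < e := by positivity
  have he3 : 3 * e ≤ 1 - ε := by have := min_le_left ((1 - ε) / 3) (κ / 2); linarith
  have heκ : e < κ := by have := min_le_right ((1 - ε) / 3) (κ / 2); linarith
  set g := √(2 / δ) with hg
  have hg2 : δ * g ^ 2 = 2 := by
    rw [hg, Real.sq_sqrt (by positivity)]
    field_simp
  have hg0 : 0 ≤ g := Real.sqrt_nonneg _
  set w := √e with hw
  have hw0 : 0 < w := Real.sqrt_pos.2 he0
  have hw2 : w ^ 2 = e := Real.sq_sqrt he0.le
  refine ⟨g / e + 1 / w, by positivity, fun {n c M θ β} h m hm => ?_⟩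
  have hβ0 := h.nonneg
  have hβ := h.beta_pos hδ
  have hβw : 0 < β / w := by positivity
  have hm' : β / w ≤ θ - g * β / e - m := by
    have h2 : (g / e + 1 / w) * β = g * β / e + β / w := by ring
    linarith
  have hr : 2 * β ^ 2 ≤ δ * (e * (g * β / e)) ^ 2 := by
    rw [mul_div_cancel₀ _ he0.ne', mul_pow, ← mul_assoc, hg2]
  have key : ∀ {c : BDChain n} {M : ℕ}, c.HittingScale M δ κ θ β → θ = c.upMean M 0 →
      ε < c.dTVMax m := fun {c M} h hθ => by
    rw [hθ] at hm'
    have hsq : β ^ 2 ≤ e * (c.upMean M 0 - g * β / e - m) ^ 2 := by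
      have h2 := mul_le_mul_of_nonneg_left (pow_le_pow_left₀ hβw.le hm' 2) he0.le
      rwa [div_pow, hw2, mul_div_cancel₀ _ he0.ne'] at h2
    have := c.one_sub_le_dTVMax hδ h.lazy h.le he0 (heκ.trans_le h.low) h.upVar_le
      (by positivity) hr (by linarith) hsq
    linarith
  rcases max_choice (c.upMean M 0) (c.rev.upMean (n - M) 0) with h' | h'
  · exact key h (h.mean_eq.trans h')
  · exact (key h.rev (h.mean_eq.trans h')).trans_le (c.rev_dTVMax_le m)

lemma exists_abs_mixD_sub_le {δ κ ε : ℝ} (hδ : 0 < δ) (hκ : 0 < κ) (hε0 : 0 < ε) (hε1 : ε < 1) :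
    ∃ C, 0 ≤ C ∧ ∀ {n : ℕ} {c : BDChain n} {M : ℕ} {θ β : ℝ}, c.HittingScale M δ κ θ β →
      |(mixD c.dTVMax ε : ℝ) - θ| ≤ C * β ∧ c.dTVMax (mixD c.dTVMax ε) ≤ ε := by
  obtain ⟨C₁, hC₁, h₁⟩ := exists_dTVMax_le hδ hκ hε0
  obtain ⟨C₂, hC₂, h₂⟩ := exists_lt_dTVMax hδ hκ hε1
  refine ⟨C₁ + √(2 / δ) + C₂, by positivity, fun {n c M θ β} h => ?_⟩
  have hβ := h.nonneg
  have hm := h₁ h ⌈θ + C₁ * β⌉₊ (Nat.le_ceil _)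
  have hmem : c.dTVMax (mixD c.dTVMax ε) ≤ ε := Nat.sInf_mem (s := {m | c.dTVMax m ≤ ε}) ⟨_, hm⟩
  have hle : (mixD c.dTVMax ε : ℝ) ≤ ⌈θ + C₁ * β⌉₊ := by
    exact_mod_cast Nat.sInf_le (s := {m | c.dTVMax m ≤ ε}) hm
  have hceil := Nat.ceil_lt_add_one (a := θ + C₁ * β) (by have := h.theta_nonneg; positivity)
  have hgt : θ - C₂ * β < mixD c.dTVMax ε := by
    by_contra! hcon
    exact absurd (h₂ h _ hcon) (not_lt.2 hmem)
  refine ⟨?_, hmem⟩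
  have h3 := h.one_le_sqrt_mul hδ
  have : 0 ≤ C₁ * β := by positivity
  have : 0 ≤ C₂ * β := by positivity
  rw [abs_le]
  constructor <;> linarith

end BDChain

namespace BDChain

lemma exp_neg_two_mul_le {l : ℝ} (h0 : 0 ≤ l) (h1 : l ≤ 1 / 2) : Real.exp (-(2 * l)) ≤ 1 - l := by
  rw [Real.exp_neg]
  refine inv_le_of_inv_le₀ (by linarith) ?_
  refine le_trans ?_ (Real.add_one_le_exp (2 * l))
  rw [inv_le_iff_one_le_mul₀ (by linarith)]
  nlinarith

/-- If the mixing time at level `ε = exp (-L) / 2` is at most `T`, then the spectral gap is at least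
of order `L / T`. -/
lemma half_le_or_le_mul_mixD {n : ℕ} (c : BDChain n) {l L : ℝ} (hL : 0 < L)
    (hl : IsSmallestNonzeroEig (1 - c.K) l)
    (hd : c.dTVMax (mixD c.dTVMax (Real.exp (-L) / 2)) ≤ Real.exp (-L) / 2) :
    1 / 2 ≤ l ∨ 0 < l ∧ L ≤ 2 * l * mixD c.dTVMax (Real.exp (-L) / 2) := by
  set T := mixD c.dTVMax (Real.exp (-L) / 2)
  have h1 : |1 - l| ^ T ≤ Real.exp (-L) := by
    linarith [c.abs_one_sub_pow_le hl.1 hl.2.1 T]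
  have hl0 : 0 < l := by
    by_contra! h
    have h2 : (1 : ℝ) ≤ |1 - l| ^ T := one_le_pow₀ (by rw [le_abs]; left; linarith)
    have := Real.exp_lt_one_iff.2 (neg_lt_zero.2 hL)
    linarith
  rcases le_or_gt (1 / 2) l with h | h
  · exact Or.inl h
  · refine Or.inr ⟨hl0, ?_⟩
    rw [abs_of_nonneg (by linarith)] at h1
    have h2 := (pow_le_pow_left₀ (Real.exp_pos _).le (exp_neg_two_mul_le hl0.le h.le) T).trans h1
    rw [← Real.exp_nat_mul, Real.exp_le_exp] at h2
    linarith

variable {F : (n : ℕ) → BDChain n} {lam : ℕ → ℝ} {M : (n : ℕ) → Fin (n + 1)} {θ β : ℕ → ℝ}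
  {δ κ : ℝ}

lemma hittingScale_of_eq {n : ℕ} (hn : 0 < n) {c : BDChain n} {M : Fin (n + 1)} {θ β : ℝ}
    (hδ : ∀ x, δ ≤ c.K x x) (hlow : κ ≤ c.piLow M) (hhigh : κ ≤ c.piHigh M)
    (hθ : θ = max (c.hitMean M 0) (c.hitMean M (Fin.last n)))
    (hβ : β = √(max (c.hitVar M 0) (c.hitVar M (Fin.last n)))) :
    c.HittingScale M δ κ θ β := by
  have hrev : (M.rev : ℕ) = n - M := by rw [Fin.val_rev]; omega
  rw [hitMean_zero_left, hitMean_last, hrev] at hθ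
  rw [hitVar_zero_left, hitVar_last, hrev] at hβ
  exact ⟨hn, Nat.le_of_lt_succ M.isLt, hδ, hlow, hhigh, hθ, hβ ▸ Real.sqrt_nonneg _,
    hβ ▸ Real.sq_sqrt ((c.upVar_nonneg _ _).trans (le_max_left _ _))⟩

lemma cutoffWindow_of_tendsto (hδ : 0 < δ) (hκ : 0 < κ)
    (hS : ∀ n, 0 < n → (F n).HittingScale (M n) δ κ (θ n) (β n))
    (h : Tendsto (fun n => θ n / β n) atTop atTop) :
    cutoffWindow (fun ε n => ((mixD ((F n).dTVMax) ε : ℕ) : ℝ)) θ β := by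
  refine ⟨?_, ?_, ?_, fun ε hε => ?_⟩
  · filter_upwards [eventually_gt_atTop 0] with n hn
    have : (0 : ℝ) < n := by exact_mod_cast hn
    linarith [(hS n hn).le_two_mul]
  · filter_upwards [eventually_gt_atTop 0] with n hn
    exact (hS n hn).beta_pos hδ
  · simpa only [Function.comp_def, inv_div] using tendsto_inv_atTop_zero.comp h
  · obtain ⟨C, -, hC⟩ := exists_abs_mixD_sub_le hδ hκ hε.1 hε.2
    refine ⟨C, ?_⟩
    filter_upwards [eventually_gt_atTop 0] with n hn
    exact (hC (hS n hn)).1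

lemma hasCutoff_of_cutoffWindow {T : ℝ → ℕ → ℝ} {t b : ℕ → ℝ} (h : cutoffWindow T t b) :
    hasCutoff T := by
  obtain ⟨ht, hb, hbt, hT⟩ := h
  refine ⟨fun n => if 0 < t n then t n else 1, fun n => by
    dsimp only; split_ifs with hn; exacts [hn, one_pos], fun ε hε => ?_⟩
  obtain ⟨C, hC⟩ := hT ε hε
  have h0 : Tendsto (fun n => T ε n / t n - 1) atTop (nhds 0) := by
    refine squeeze_zero_norm' ?_ (by simpa using hbt.const_mul C)
    filter_upwards [ht, hC] with n hn hCn
    rw [Real.norm_eq_abs, div_sub_one hn.ne', abs_div, abs_of_pos hn, ← mul_div_assoc]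
    exact div_le_div_of_nonneg_right hCn hn.le
  have h1 := h0.add_const 1
  rw [zero_add] at h1
  refine h1.congr' ?_
  filter_upwards [ht] with n hn
  rw [if_pos hn, sub_add_cancel]

lemma tendsto_div_of_tendsto_mul (hδ : 0 < δ) (hκ : 0 < κ)
    (hS : ∀ n, 0 < n → (F n).HittingScale (M n) δ κ (θ n) (β n))
    (hlam : ∀ n, 0 < n → IsSmallestNonzeroEig (1 - (F n).K) (lam n))
    (h : Tendsto (fun n => θ n * lam n) atTop atTop) :
    Tendsto (fun n => θ n / β n) atTop atTop := by
  have h1 : Tendsto (fun n => √(κ / 4 * (θ n * lam n))) atTop atTop :=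
    Real.tendsto_sqrt_atTop.comp (h.const_mul_atTop (by positivity))
  refine tendsto_atTop_mono' _ ?_ h1
  filter_upwards [eventually_gt_atTop 0, h.eventually_gt_atTop 0] with n hn hpos
  have hθ := (hS n hn).theta_nonneg
  have hβ := (hS n hn).beta_pos hδ
  have hl : 0 < lam n := pos_of_mul_pos_right hpos hθ
  have hk := (hS n hn).mul_sq_le hκ hl ((F n).poincare_of_isSmallestNonzeroEig (hlam n hn))
  refine Real.sqrt_le_iff.2 ⟨by positivity, ?_⟩
  rw [div_pow, le_div_iff₀ (by positivity)]
  have := mul_le_mul_of_nonneg_left hk hθ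
  linarith

lemma tendsto_mul_of_hasCutoff (hδ : 0 < δ) (hκ : 0 < κ)
    (hS : ∀ n, 0 < n → (F n).HittingScale (M n) δ κ (θ n) (β n))
    (hlam : ∀ n, 0 < n → IsSmallestNonzeroEig (1 - (F n).K) (lam n))
    (h : hasCutoff (fun ε n => ((mixD ((F n).dTVMax) ε : ℕ) : ℝ))) :
    Tendsto (fun n => θ n * lam n) atTop atTop := by
  obtain ⟨t, ht, hT⟩ := h
  obtain ⟨C, hC0, hC⟩ := exists_abs_mixD_sub_le hδ hκ (ε := 1 / 2) (by norm_num) (by norm_num)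
  refine tendsto_atTop.2 fun b => ?_
  set B := max b 1
  have hB : 0 < B := lt_max_of_lt_right one_pos
  set L := 8 * (1 + 2 * C) * B with hLdef
  have hL : 0 < L := by positivity
  have hε0 : 0 < Real.exp (-L) / 2 := by positivity
  have hε1 : Real.exp (-L) / 2 < 1 := by
    have := Real.exp_lt_one_iff.2 (neg_lt_zero.2 hL)
    linarith
  obtain ⟨_, -, hd⟩ := exists_abs_mixD_sub_le hδ hκ hε0 hε1
  have e1 := (hT (1 / 2) (by norm_num)).eventually_const_lt (show (1 / 2 : ℝ) < 1 by norm_num)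
  have e2 := (hT _ ⟨hε0, hε1⟩).eventually_lt_const (show (1 : ℝ) < 2 by norm_num)
  have e3 := tendsto_natCast_atTop_atTop (R := ℝ).eventually_ge_atTop (4 * B)
  filter_upwards [eventually_gt_atTop 0, e1, e2, e3] with n hn h1 h2 h3
  refine (le_max_left b 1).trans ?_
  have hs := hS n hn
  have hθ := hs.theta_nonneg
  rw [lt_div_iff₀ (ht n)] at h1
  rw [div_lt_iff₀ (ht n)] at h2
  rcases (F n).half_le_or_le_mul_mixD hL (hlam n hn) (hd hs).2 with hl | ⟨hl, hle⟩
  · have := mul_le_mul_of_nonneg_left hl hθ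
    linarith [hs.le_two_mul]
  · have hβ : β n ≤ 2 * θ n := by
      refine le_of_sq_le_sq ?_ (by positivity)
      nlinarith [hs.sq_le]
    have h4 := (abs_le.1 (hC hs).1).2
    have h5 := mul_le_mul_of_nonneg_left hβ hC0
    have h6 : (mixD (F n).dTVMax (Real.exp (-L) / 2) : ℝ) ≤ 4 * ((1 + 2 * C) * θ n) := by
      linarith
    have h7 := mul_le_mul_of_nonneg_left h6 (show 0 ≤ 2 * lam n by positivity)
    have h8 : 8 * (1 + 2 * C) * B ≤ 8 * (1 + 2 * C) * (θ n * lam n) := by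
      linarith
    exact le_of_mul_le_mul_left h8 (by positivity)

end BDChain

/-- Theorem `t-tv2`(2).  Discrete-time version: assuming
`inf_{i,n} K_n(i,i) > 0`, with `θ_n = max{E_0 τ_{M_n}, E_n τ_{M_n}}` and
`β_n² = max{Var_0 τ_{M_n}, Var_n τ_{M_n}}`, the family `F` has a maximum total variation
cutoff iff `θ_n λ_n → ∞` iff `θ_n / β_n → ∞`, in which case it has a `(θ_n, β_n)` cutoff. -/
theorem birth_death_discrete_maxTV_cutoff
    (F : (n : ℕ) → BDChain n) (lam : ℕ → ℝ)
    (hlam : ∀ n, 0 < n → IsSmallestNonzeroEig (1 - (F n).K) (lam n))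
    (hlazy : ∃ δ > (0 : ℝ), ∀ n, ∀ i : Fin (n + 1), δ ≤ (F n).K i i)
    (M : (n : ℕ) → Fin (n + 1))
    (hMlow : ∃ c > 0, ∀ n, c ≤ (F n).piLow (M n))
    (hMhigh : ∃ c > 0, ∀ n, c ≤ (F n).piHigh (M n))
    (θ β : ℕ → ℝ)
    (hθ : ∀ n, θ n = max ((F n).hitMean (M n) 0) ((F n).hitMean (M n) (Fin.last n)))
    (hβ : ∀ n, β n =
      Real.sqrt (max ((F n).hitVar (M n) 0) ((F n).hitVar (M n) (Fin.last n)))) :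
    (hasCutoff (fun ε n => ((mixD ((F n).dTVMax) ε : ℕ) : ℝ)) ↔
      Filter.Tendsto (fun n => θ n * lam n) Filter.atTop Filter.atTop) ∧
    (hasCutoff (fun ε n => ((mixD ((F n).dTVMax) ε : ℕ) : ℝ)) ↔
      Filter.Tendsto (fun n => θ n / β n) Filter.atTop Filter.atTop) ∧
    (hasCutoff (fun ε n => ((mixD ((F n).dTVMax) ε : ℕ) : ℝ)) →
      cutoffWindow (fun ε n => ((mixD ((F n).dTVMax) ε : ℕ) : ℝ)) θ β) := by
  obtain ⟨δ, hδ, hlazy⟩ := hlazy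
  obtain ⟨a, ha, hlow⟩ := hMlow
  obtain ⟨b, hb, hhigh⟩ := hMhigh
  have hκ : 0 < min a b := lt_min ha hb
  have hS : ∀ n, 0 < n → (F n).HittingScale (M n) δ (min a b) (θ n) (β n) := fun n hn =>
    BDChain.hittingScale_of_eq hn (hlazy n) ((min_le_left _ _).trans (hlow n))
      ((min_le_right _ _).trans (hhigh n)) (hθ n) (hβ n)
  have cut_gap := BDChain.tendsto_mul_of_hasCutoff hδ hκ hS hlam
  have gap_dev := BDChain.tendsto_div_of_tendsto_mul hδ hκ hS hlam
  have dev_window := BDChain.cutoffWindow_of_tendsto hδ hκ hS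
  have dev_cut := fun h => BDChain.hasCutoff_of_cutoffWindow (dev_window h)
  exact ⟨⟨cut_gap, fun h => dev_cut (gap_dev h)⟩, ⟨fun h => gap_dev (cut_gap h), dev_cut⟩,
    fun h => dev_window (gap_dev (cut_gap h))⟩

end
end

section
/- Let K be the transition matrix of an irreducible birth and death chain on {0,1,...,n}. For 1 ≤ i ≤ n, let β^{(i)}_1,...,β^{(i)}_i be the eigenvalues of the principal submatrix of I − K indexed by {0,...,i−1}. Then β^{(i)}_j ∈ (0,2) for all 1 ≤ j ≤ i, and the hitting times from state 0 satisfy E_0 τ_i = E_0 τ̃_i = Σ_{j=1}^i 1/β^{(i)}_j, Var_0(τ_i) = Σ_{j=1}^i (1 − β^{(i)}_j)/(β^{(i)}_j)², and Var_0(τ̃_i) = Σ_{j=1}^i 1/(β^{(i)}_j)². -/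
open scoped BigOperators
open Filter Matrix Polynomial MeasureTheory

noncomputable section

/-! ### Low-order coefficients of a split polynomial -/

section Coefficients

variable {ι : Type*} (s : Finset ι) (β : ι → ℝ)

lemma coeff_zero_prod_X_sub_C_ne_zero (hβ : ∀ j ∈ s, β j ≠ 0) :
    (∏ j ∈ s, (X - C (β j))).coeff 0 ≠ 0 := by
  rw [Polynomial.coeff_zero_prod, Finset.prod_ne_zero_iff]
  intro j hj
  simpa using hβ j hj

lemma coeff_one_prod_X_sub_C (hβ : ∀ j ∈ s, β j ≠ 0) :
    (∏ j ∈ s, (X - C (β j))).coeff 1 =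
      -((∏ j ∈ s, (X - C (β j))).coeff 0 * ∑ j ∈ s, (β j)⁻¹) := by
  classical
  induction s using Finset.induction_on with
  | empty => simp [Polynomial.coeff_one]
  | insert a s ha ih =>
    have hs := ih fun j hj => hβ j (Finset.mem_insert_of_mem hj)
    have h0 : β a ≠ 0 := hβ a (Finset.mem_insert_self a s)
    rw [Finset.prod_insert ha, Finset.sum_insert ha]
    simp only [sub_mul, Polynomial.coeff_sub, Polynomial.coeff_C_mul, Polynomial.coeff_X_mul_zero,
      Polynomial.coeff_X_mul, hs]
    field_simp
    ring

lemma coeff_two_prod_X_sub_C (hβ : ∀ j ∈ s, β j ≠ 0) :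
    (∏ j ∈ s, (X - C (β j))).coeff 2 =
      (∏ j ∈ s, (X - C (β j))).coeff 0 *
        (((∑ j ∈ s, (β j)⁻¹) ^ 2 - ∑ j ∈ s, ((β j) ^ 2)⁻¹) / 2) := by
  classical
  induction s using Finset.induction_on with
  | empty => simp [Polynomial.coeff_one]
  | insert a s ha ih =>
    have hs' : ∀ j ∈ s, β j ≠ 0 := fun j hj => hβ j (Finset.mem_insert_of_mem hj)
    have hs := ih hs'
    have h0 : β a ≠ 0 := hβ a (Finset.mem_insert_self a s)
    rw [Finset.prod_insert ha, Finset.sum_insert ha, Finset.sum_insert ha]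
    simp only [sub_mul, Polynomial.coeff_sub, Polynomial.coeff_C_mul, Polynomial.coeff_X_mul_zero,
      Polynomial.coeff_X_mul, hs, coeff_one_prod_X_sub_C s β hs']
    field_simp
    ring

end Coefficients

/-! ### Nonnegative matrices and strictly superharmonic vectors -/

section Superharmonic

variable {ι : Type*} [Fintype ι] {Q : Matrix ι ι ℝ} {h : ι → ℝ} {r : ℝ}

lemma mulVec_le_mulVec_of_nonneg (hQ : ∀ a b, 0 ≤ Q a b) {u v : ι → ℝ} (huv : u ≤ v) :
    Q *ᵥ u ≤ Q *ᵥ v :=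
  fun a => Finset.sum_le_sum fun b _ => mul_le_mul_of_nonneg_left (huv b) (hQ a b)

lemma pow_succ_mulVec [DecidableEq ι] (Q : Matrix ι ι ℝ) (m : ℕ) (v : ι → ℝ) :
    Q ^ (m + 1) *ᵥ v = Q *ᵥ (Q ^ m *ᵥ v) := by
  rw [pow_succ', mulVec_mulVec]

lemma pow_mulVec_nonneg [DecidableEq ι] (hQ : ∀ a b, 0 ≤ Q a b) {v : ι → ℝ} (hv : 0 ≤ v)
    (m : ℕ) : 0 ≤ Q ^ m *ᵥ v := by
  induction m with
  | zero => simpa using hv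
  | succ m ih =>
    rw [pow_succ_mulVec]
    simpa using mulVec_le_mulVec_of_nonneg hQ ih

lemma pow_mulVec_le_of_mulVec_le [DecidableEq ι] (hQ : ∀ a b, 0 ≤ Q a b) (hr : 0 ≤ r)
    (hh : Q *ᵥ h ≤ r • h) {v : ι → ℝ} (hv : v ≤ h) (m : ℕ) : Q ^ m *ᵥ v ≤ r ^ m • h := by
  induction m with
  | zero => simpa using hv
  | succ m ih =>
    rw [pow_succ_mulVec]
    calc Q *ᵥ (Q ^ m *ᵥ v) ≤ Q *ᵥ (r ^ m • h) := mulVec_le_mulVec_of_nonneg hQ ih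
      _ = r ^ m • Q *ᵥ h := mulVec_smul _ _ _
      _ ≤ r ^ m • r • h := smul_le_smul_of_nonneg_left hh (by positivity)
      _ = r ^ (m + 1) • h := by rw [smul_smul, pow_succ]

lemma abs_le_of_mulVec_eq_smul (hQ : ∀ a b, 0 ≤ Q a b) (hpos : ∀ a, 0 < h a)
    (hh : Q *ᵥ h ≤ r • h) {v : ι → ℝ} (hv : v ≠ 0) {l : ℝ} (hl : Q *ᵥ v = l • v) :
    |l| ≤ r := by
  obtain ⟨b, hb⟩ := Function.ne_iff.mp hv
  have : Nonempty ι := ⟨b⟩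
  obtain ⟨x, hx⟩ := Finite.exists_max fun a => |v a| / h a
  set c := |v x| / h x with hc
  have hle : ∀ a, |v a| ≤ c * h a := fun a => (div_le_iff₀ (hpos a)).1 (hx a)
  have hcx : |v x| = c * h x := by rw [hc, div_mul_cancel₀ _ (hpos x).ne']
  have hc0 : 0 < c := lt_of_lt_of_le (div_pos (abs_pos.2 hb) (hpos b)) (hx b)
  have key : |l| * |v x| ≤ r * |v x| :=
    calc |l| * |v x| = |∑ a, Q x a * v a| := by
          rw [← abs_mul]; exact congrArg abs (congrFun hl x).symm
      _ ≤ ∑ a, |Q x a * v a| := Finset.abs_sum_le_sum_abs _ _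
      _ ≤ ∑ a, c * (Q x a * h a) := by
          refine Finset.sum_le_sum fun a _ => ?_
          rw [abs_mul, abs_of_nonneg (hQ x a), mul_left_comm]
          exact mul_le_mul_of_nonneg_left (hle a) (hQ x a)
      _ = c * (Q *ᵥ h) x := by rw [← Finset.mul_sum]; rfl
      _ ≤ c * (r * h x) := mul_le_mul_of_nonneg_left (hh x) hc0.le
      _ = r * |v x| := by rw [hcx]; ring
  exact le_of_mul_le_mul_right key (by rw [hcx]; exact mul_pos hc0 (hpos x))

/-- If some power of a nonnegative matrix has all row sums smaller than one, then the matrix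
admits a strictly superharmonic vector bounded below by one. -/
lemma exists_superharmonic_of_pow_mulVec_one_lt [DecidableEq ι] (hQ : ∀ a b, 0 ≤ Q a b)
    {N : ℕ} (hN : N ≠ 0) (hlt : ∀ a, (Q ^ N *ᵥ 1) a < 1) :
    ∃ (h : ι → ℝ) (r : ℝ), 0 ≤ r ∧ r < 1 ∧ 1 ≤ h ∧ Q *ᵥ h ≤ r • h := by
  rcases isEmpty_or_nonempty ι with hι | hι
  · exact ⟨1, 0, le_rfl, zero_lt_one, le_rfl, fun a => hι.elim a⟩
  set h : ι → ℝ := ∑ m ∈ Finset.range N, Q ^ m *ᵥ 1 with hdef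
  have hone : (1 : ι → ℝ) ≤ h := by
    have := Finset.single_le_sum (f := fun m => Q ^ m *ᵥ (1 : ι → ℝ)) (s := Finset.range N)
      (fun m _ => pow_mulVec_nonneg hQ zero_le_one m)
      (Finset.mem_range.2 (Nat.pos_of_ne_zero hN))
    simpa using this
  have hpos : ∀ a, 0 < h a := fun a => lt_of_lt_of_le zero_lt_one (hone a)
  have hQh : Q *ᵥ h = h + Q ^ N *ᵥ 1 - 1 := by
    have h1 : Q *ᵥ h = ∑ m ∈ Finset.range N, Q ^ (m + 1) *ᵥ 1 := by
      simp only [pow_succ_mulVec, hdef]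
      exact map_sum (Matrix.mulVecLin Q) _ _
    have h2 := Finset.sum_range_succ (fun m => Q ^ m *ᵥ (1 : ι → ℝ)) N
    rw [Finset.sum_range_succ', ← h1, ← hdef, pow_zero, one_mulVec] at h2
    rw [← h2, add_sub_cancel_right]
  obtain ⟨x, hx⟩ := Finite.exists_max fun a => (Q *ᵥ h) a / h a
  refine ⟨h, (Q *ᵥ h) x / h x, ?_, ?_, hone, fun a => ?_⟩
  · refine div_nonneg ?_ (hpos x).le
    exact Finset.sum_nonneg fun b _ => mul_nonneg (hQ x b) (hpos b).le
  · rw [div_lt_one (hpos x), hQh]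
    have := hlt x
    simp only [Pi.sub_apply, Pi.add_apply, Pi.one_apply]
    linarith
  · exact (div_le_iff₀ (hpos a)).1 (hx a)

lemma summable_pow_mulVec_one [DecidableEq ι] (hQ : ∀ a b, 0 ≤ Q a b) (hr0 : 0 ≤ r) (hr1 : r < 1)
    (hone : 1 ≤ h) (hh : Q *ᵥ h ≤ r • h) (a : ι) : Summable fun m : ℕ => (Q ^ m *ᵥ 1) a :=
  Summable.of_nonneg_of_le (fun m => pow_mulVec_nonneg hQ zero_le_one m a)
    (fun m => pow_mulVec_le_of_mulVec_le hQ hr0 hh hone m a)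
    ((summable_geometric_of_lt_one hr0 hr1).mul_right (h a))

lemma summable_mul_pow_mulVec_one [DecidableEq ι] (hQ : ∀ a b, 0 ≤ Q a b) (hr0 : 0 ≤ r) (hr1 : r < 1)
    (hone : 1 ≤ h) (hh : Q *ᵥ h ≤ r • h) (a : ι) :
    Summable fun m : ℕ => (m : ℝ) * (Q ^ m *ᵥ 1) a := by
  have hsum : Summable fun m : ℕ => (m : ℝ) * r ^ m := by
    simpa using summable_pow_mul_geometric_of_norm_lt_one 1
      (show ‖r‖ < 1 by rwa [Real.norm_of_nonneg hr0])
  refine Summable.of_nonneg_of_le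
    (fun m => mul_nonneg m.cast_nonneg (pow_mulVec_nonneg hQ zero_le_one m a))
    (fun m => ?_) (hsum.mul_right (h a))
  rw [mul_assoc]
  exact mul_le_mul_of_nonneg_left (pow_mulVec_le_of_mulVec_le hQ hr0 hh hone m a) m.cast_nonneg

lemma mulVec_tsum {f : ℕ → ι → ℝ} (hf : ∀ a, Summable fun m => f m a) (a : ι) :
    (Q *ᵥ fun b => ∑' m, f m b) a = ∑' m, (Q *ᵥ f m) a := by
  simp only [mulVec, dotProduct, ← tsum_mul_left]
  exact (Summable.tsum_finsetSum fun b _ => (hf b).mul_left _).symm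

/-- The potential `∑ Qᵐ 1` solves the Poisson equation with right-hand side `1`. -/
lemma one_sub_mulVec_tsum [DecidableEq ι] (hsum : ∀ a, Summable fun m : ℕ => (Q ^ m *ᵥ 1) a) :
    ((1 - Q) *ᵥ fun a => ∑' m : ℕ, (Q ^ m *ᵥ 1) a) = 1 := by
  funext a
  rw [sub_mulVec, one_mulVec, Pi.sub_apply, mulVec_tsum hsum, (hsum a).tsum_eq_zero_add]
  simp only [← pow_succ_mulVec, pow_zero, one_mulVec, add_sub_cancel_right]

lemma one_sub_mulVec_tsum_succ_mul [DecidableEq ι]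
    (hsum : ∀ a, Summable fun m : ℕ => (Q ^ m *ᵥ 1) a)
    (hsum' : ∀ a, Summable fun m : ℕ => (m : ℝ) * (Q ^ m *ᵥ 1) a) :
    ((1 - Q) *ᵥ fun a => ∑' m : ℕ, ((m : ℝ) + 1) * (Q ^ m *ᵥ 1) a) =
      fun a => ∑' m : ℕ, (Q ^ m *ᵥ 1) a := by
  have hs : ∀ a, Summable fun m : ℕ => (((m : ℝ) + 1) • (Q ^ m *ᵥ 1)) a := fun a => by
    simpa [add_mul] using (hsum' a).add (hsum a)
  funext a
  rw [sub_mulVec, one_mulVec, Pi.sub_apply]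
  have h1 := mulVec_tsum (Q := Q) hs a
  simp only [Pi.smul_apply, smul_eq_mul, mulVec_smul, ← pow_succ_mulVec] at h1
  have h2 := (hsum' a).tsum_eq_zero_add
  push_cast at h2
  have h3 : ∑' m : ℕ, ((m : ℝ) + 1) * (Q ^ m *ᵥ 1) a =
      ∑' m : ℕ, (m : ℝ) * (Q ^ m *ᵥ 1) a + ∑' m : ℕ, (Q ^ m *ᵥ 1) a := by
    simp only [add_mul, one_mul]
    exact (hsum' a).tsum_add (hsum a)
  rw [h1, h3, h2]
  ring

end Superharmonic

/-! ### Principal submatrices of tridiagonal stochastic matrices -/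

section Upper

variable {N : ℕ} {S : Matrix (Fin N) (Fin N) ℝ}

lemma pow_mulVec_one_apply_eq_zero
    (htri : ∀ a b : Fin N, (a : ℕ) + 1 < b → S a b = 0)
    (hrow : ∀ a : Fin N, (a : ℕ) + 1 < N → (S *ᵥ 1) a = 0)
    (k : ℕ) (a : Fin N) (hak : (a : ℕ) + (k + 1) < N) : (S ^ (k + 1) *ᵥ 1) a = 0 := by
  induction k generalizing a with
  | zero => simpa using hrow a hak
  | succ k ih =>
    rw [pow_succ_mulVec, mulVec, dotProduct]
    refine Finset.sum_eq_zero fun b _ => ?_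
    by_cases hb : (a : ℕ) + 1 < b
    · rw [htri a b hb, zero_mul]
    · rw [ih b (by omega), mul_zero]

/-- Cayley-Hamilton applied to a vector and evaluated at a coordinate. -/
lemma sum_coeff_charpoly_mul (v : Fin N → ℝ) (a : Fin N) {M : ℕ} (hM : N < M) :
    ∑ k ∈ Finset.range M, S.charpoly.coeff k * (S ^ k *ᵥ v) a = 0 := by
  have h := Polynomial.aeval_eq_sum_range' (p := S.charpoly) (n := M)
    (by rwa [Matrix.charpoly_natDegree_eq_dim, Fintype.card_fin]) S
  rw [Matrix.aeval_self_charpoly] at h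
  have h2 := congrFun (congrArg (fun T => T *ᵥ v) h) a
  simpa [Matrix.sum_mulVec, smul_mulVec] using h2.symm

lemma sum_coeff_mul_pow_mulVec_one (hN : 0 < N)
    (htri : ∀ a b : Fin N, (a : ℕ) + 1 < b → S a b = 0)
    (hrow : ∀ a : Fin N, (a : ℕ) + 1 < N → (S *ᵥ 1) a = 0) (f : ℕ → ℝ) :
    ∑ k ∈ Finset.range N, f k * (S ^ k *ᵥ 1) ⟨0, hN⟩ = f 0 := by
  rw [Finset.sum_eq_single_of_mem 0 (Finset.mem_range.2 hN)]
  · simp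
  · intro k hk hk0
    obtain ⟨k, rfl⟩ := Nat.exists_eq_succ_of_ne_zero hk0
    rw [Nat.succ_eq_add_one, pow_mulVec_one_apply_eq_zero htri hrow k, mul_zero]
    simpa using hk

lemma coeff_zero_mul_add_coeff_one (hN : 0 < N)
    (htri : ∀ a b : Fin N, (a : ℕ) + 1 < b → S a b = 0)
    (hrow : ∀ a : Fin N, (a : ℕ) + 1 < N → (S *ᵥ 1) a = 0)
    {u : Fin N → ℝ} (hu : S *ᵥ u = 1) :
    S.charpoly.coeff 0 * u ⟨0, hN⟩ + S.charpoly.coeff 1 = 0 := by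
  have h := sum_coeff_charpoly_mul (S := S) u ⟨0, hN⟩ (M := N + 1) (by omega)
  rw [Finset.sum_range_succ'] at h
  simp only [pow_succ, ← mulVec_mulVec, hu, pow_zero, one_mulVec] at h
  rw [sum_coeff_mul_pow_mulVec_one hN htri hrow fun k => S.charpoly.coeff (k + 1)] at h
  linarith

lemma coeff_zero_mul_add_coeff_one_mul_add_coeff_two (hN : 0 < N)
    (htri : ∀ a b : Fin N, (a : ℕ) + 1 < b → S a b = 0)
    (hrow : ∀ a : Fin N, (a : ℕ) + 1 < N → (S *ᵥ 1) a = 0)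
    {u w : Fin N → ℝ} (hu : S *ᵥ u = 1) (hw : S *ᵥ w = u) :
    S.charpoly.coeff 0 * w ⟨0, hN⟩ + S.charpoly.coeff 1 * u ⟨0, hN⟩ + S.charpoly.coeff 2 = 0 := by
  have h := sum_coeff_charpoly_mul (S := S) w ⟨0, hN⟩ (M := N + 2) (by omega)
  rw [Finset.sum_range_succ', Finset.sum_range_succ'] at h
  simp only [pow_succ, ← mulVec_mulVec, hw, hu, pow_zero, one_mulVec] at h
  rw [sum_coeff_mul_pow_mulVec_one hN htri hrow fun k => S.charpoly.coeff (k + 1 + 1)] at h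
  simp only [zero_add, Nat.reduceAdd] at h
  linarith

lemma pow_mulVec_one_lt_one {Q : Matrix (Fin N) (Fin N) ℝ} (hQ : ∀ a b, 0 ≤ Q a b)
    (hrow : ∀ a, (Q *ᵥ 1) a ≤ 1)
    (hlast : ∀ a : Fin N, (a : ℕ) + 1 = N → (Q *ᵥ 1) a < 1)
    (hup : ∀ a b : Fin N, (a : ℕ) + 1 = b → 0 < Q a b) :
    ∀ a, (Q ^ N *ᵥ 1) a < 1 := by
  have hle : ∀ m : ℕ, Q ^ m *ᵥ 1 ≤ (1 : Fin N → ℝ) := fun m => by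
    simpa using pow_mulVec_le_of_mulVec_le (h := 1) (r := 1) hQ zero_le_one
      (by rw [one_smul]; exact hrow) le_rfl m
  have key : ∀ (m : ℕ) (a : Fin N), N ≤ a + m → (Q ^ m *ᵥ 1) a < 1 := by
    intro m
    induction m with
    | zero => intro a ha; omega
    | succ m ih =>
      intro a ha
      rw [pow_succ_mulVec]
      by_cases hN : (a : ℕ) + 1 = N
      · exact (mulVec_le_mulVec_of_nonneg hQ (hle m) a).trans_lt (hlast a hN)
      · refine lt_of_lt_of_le ?_ (hrow a)
        have hb : (a : ℕ) + 1 < N := by omega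
        refine Finset.sum_lt_sum
          (fun b _ => mul_le_mul_of_nonneg_left (hle m b) (hQ a b))
          ⟨⟨a + 1, hb⟩, Finset.mem_univ _, ?_⟩
        exact mul_lt_mul_of_pos_left (ih _ (by simp only; omega)) (hup a _ rfl)
  exact fun a => key N a (by omega)

end Upper

/-! ### Poissonization -/

section Poisson

lemma integrableOn_exp_neg_mul_pow (m : ℕ) :
    IntegrableOn (fun t : ℝ => Real.exp (-t) * t ^ m) (Set.Ioi 0) := by
  have h := Real.GammaIntegral_convergent (s := m + 1) (by positivity)
  simpa using h

lemma integral_exp_neg_mul_pow (m : ℕ) :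
    ∫ t in Set.Ioi (0 : ℝ), Real.exp (-t) * t ^ m = m.factorial := by
  have h := Real.Gamma_eq_integral (s := m + 1) (by positivity)
  rw [Real.Gamma_nat_eq_factorial] at h
  simpa using h.symm

lemma integral_tsum_exp_neg_mul_pow {a : ℕ → ℝ} (ha : ∀ m, 0 ≤ a m) (k : ℕ)
    (hs : Summable fun m => a m * (m + k).factorial) :
    ∫ t in Set.Ioi (0 : ℝ), ∑' m, a m * (Real.exp (-t) * t ^ (m + k)) =
      ∑' m, a m * (m + k).factorial := by
  have hint : ∀ m, ∫ t in Set.Ioi (0 : ℝ), a m * (Real.exp (-t) * t ^ (m + k)) =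
      a m * (m + k).factorial := fun m => by
    rw [integral_const_mul, integral_exp_neg_mul_pow]
  have hnorm : ∀ m, ∫ t in Set.Ioi (0 : ℝ), ‖a m * (Real.exp (-t) * t ^ (m + k))‖ =
      a m * (m + k).factorial := fun m => by
    rw [← hint m]
    refine setIntegral_congr_fun measurableSet_Ioi fun t ht => Real.norm_of_nonneg ?_
    have ht' : 0 < t := ht
    exact mul_nonneg (ha m) (by positivity)
  have h := hasSum_integral_of_summable_integral_norm
    (fun m => (integrableOn_exp_neg_mul_pow (m + k)).const_mul (a m))
    (by simpa only [hnorm] using hs)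
  simp only [hint] at h
  exact h.tsum_eq.symm

lemma integral_tsum_poisson {s : ℕ → ℝ} (hs0 : ∀ m, 0 ≤ s m) (hs : Summable s) :
    ∫ t in Set.Ioi (0 : ℝ), ∑' m : ℕ, (Real.exp (-t) * t ^ m / m.factorial) * s m =
      ∑' m, s m := by
  have heq : ∀ m : ℕ, s m / m.factorial * (m + 0).factorial = s m := fun m => by
    rw [add_zero, div_mul_cancel₀ _ (by positivity)]
  have h := integral_tsum_exp_neg_mul_pow (a := fun m => s m / m.factorial)
    (fun m => div_nonneg (hs0 m) (by positivity)) 0 (by simpa only [heq] using hs)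
  simp only [heq] at h
  rw [← h]
  congr! 4 with t m
  ring

lemma integral_mul_tsum_poisson {s : ℕ → ℝ} (hs0 : ∀ m, 0 ≤ s m)
    (hs : Summable fun m : ℕ => ((m : ℝ) + 1) * s m) :
    ∫ t in Set.Ioi (0 : ℝ),
        2 * t * ∑' m : ℕ, (Real.exp (-t) * t ^ m / m.factorial) * s m =
      2 * ∑' m : ℕ, ((m : ℝ) + 1) * s m := by
  have heq : ∀ m : ℕ, s m / m.factorial * (m + 1).factorial = ((m : ℝ) + 1) * s m := fun m => by
    rw [Nat.factorial_succ]
    push_cast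
    field_simp
  have h := integral_tsum_exp_neg_mul_pow (a := fun m => s m / m.factorial)
    (fun m => div_nonneg (hs0 m) (by positivity)) 1 (by simpa only [heq] using hs)
  simp only [heq] at h
  rw [← h, ← integral_const_mul]
  congr! 2 with t
  rw [mul_assoc, ← tsum_mul_left]
  congr! 3 with m
  ring

end Poisson

/-! ### The chain below a fixed state -/

namespace BDChain

variable {n : ℕ} (c : BDChain n) (i : Fin (n + 1))

/-- The principal submatrix of `K` indexed by the states `0, 1, ..., i-1`. -/
def subK : Matrix (Fin (i : ℕ)) (Fin (i : ℕ)) ℝ :=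
  Matrix.of fun a b => c.K (Fin.castLE i.isLt.le a) (Fin.castLE i.isLt.le b)

lemma subIK_eq_one_sub_subK : c.subIK i = 1 - c.subK i := by
  ext a b
  simp [subIK, subK, Matrix.one_apply]

lemma subK_nonneg (a b : Fin (i : ℕ)) : 0 ≤ c.subK i a b := c.K_nonneg _ _

lemma subK_eq_zero {a b : Fin (i : ℕ)} (hab : (a : ℕ) + 1 < b) : c.subK i a b = 0 := by
  refine c.K_tridiag _ _ ?_
  simp only [Fin.val_castLE]
  rw [lt_abs]
  omega

lemma subK_pos {a b : Fin (i : ℕ)} (hab : (a : ℕ) + 1 = b) : 0 < c.subK i a b := by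
  have h := (c.K_irred a (by omega)).1
  have hb : Fin.castLE i.isLt.le b = ⟨a + 1, by omega⟩ := Fin.ext hab.symm
  rw [subK, Matrix.of_apply, hb]
  exact h

lemma notMem_range_castLE {y : Fin (n + 1)} :
    y ∉ Set.range (Fin.castLE i.isLt.le : Fin (i : ℕ) → Fin (n + 1)) ↔ i ≤ y := by
  rw [Fin.range_castLE]
  simp

lemma subK_mulVec_one_eq {a : Fin (i : ℕ)} (ha : (a : ℕ) + 1 < i) : (c.subK i *ᵥ 1) a = 1 := by
  rw [← c.K_rowSum (Fin.castLE i.isLt.le a)]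
  refine Fintype.sum_of_injective _ (Fin.castLE_injective i.isLt.le) _ _ (fun y hy => ?_)
    fun b => by simp [subK]
  rw [notMem_range_castLE, Fin.le_def] at hy
  refine c.K_tridiag _ _ ?_
  simp only [Fin.val_castLE]
  rw [lt_abs]
  omega

lemma subK_mulVec_one_lt {a : Fin (i : ℕ)} (ha : (a : ℕ) + 1 = i) : (c.subK i *ᵥ 1) a < 1 := by
  have hpos := (c.K_irred a (by omega)).1
  have hi : (⟨a + 1, by omega⟩ : Fin (n + 1)) = i := Fin.ext ha
  rw [hi] at hpos
  have hsum : (c.subK i *ᵥ 1) a =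
      ∑ y, if y < i then c.K (Fin.castLE i.isLt.le a) y else 0 := by
    refine Fintype.sum_of_injective _ (Fin.castLE_injective i.isLt.le) _ _ (fun y hy => ?_)
      fun b => ?_
    · rw [notMem_range_castLE] at hy
      rw [if_neg hy.not_gt]
    · rw [if_pos (Fin.lt_def.2 b.isLt)]
      simp [subK]
  rw [hsum, ← c.K_rowSum (Fin.castLE i.isLt.le a)]
  refine Finset.sum_lt_sum (fun y _ => ?_) ⟨i, Finset.mem_univ _, ?_⟩
  · split_ifs
    exacts [le_rfl, c.K_nonneg _ _]
  · rw [if_neg (lt_irrefl i)]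
    exact hpos

lemma subK_mulVec_one_le (a : Fin (i : ℕ)) : (c.subK i *ᵥ 1) a ≤ 1 := by
  rcases (Nat.succ_le_of_lt a.isLt).lt_or_eq with ha | ha
  · exact (c.subK_mulVec_one_eq i ha).le
  · exact (c.subK_mulVec_one_lt i ha).le

lemma killed_pow_mulVec_one (m : ℕ) (a : Fin (i : ℕ)) :
    (c.killed i ^ m *ᵥ 1) (Fin.castLE i.isLt.le a) = (c.subK i ^ m *ᵥ 1) a := by
  induction m generalizing a with
  | zero => simp
  | succ m ih =>
    have hne : ∀ b : Fin (i : ℕ), Fin.castLE i.isLt.le b ≠ i := fun b hb => by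
      have := congrArg Fin.val hb
      simp only [Fin.val_castLE] at this
      omega
    rw [pow_succ_mulVec, pow_succ_mulVec]
    refine (Fintype.sum_of_injective _ (Fin.castLE_injective i.isLt.le) _ _ (fun y hy => ?_)
      fun b => ?_).symm
    · rw [notMem_range_castLE, Fin.le_def] at hy
      refine mul_eq_zero_of_left ?_ _
      simp only [killed, Matrix.of_apply]
      split_ifs with h
      · rfl
      · push Not at h
        have hyi : (y : ℕ) ≠ i := fun h' => h.2 (Fin.ext h')
        refine c.K_tridiag _ _ ?_
        simp only [Fin.val_castLE]
        rw [lt_abs]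
        omega
    · rw [ih b]
      simp [killed, subK, hne]

lemma hitSurv_castLE (m : ℕ) (a : Fin (i : ℕ)) :
    c.hitSurv i (Fin.castLE i.isLt.le a) m = (c.subK i ^ m *ᵥ 1) a := by
  have hne : Fin.castLE i.isLt.le a ≠ i := fun hb => by
    have := congrArg Fin.val hb
    simp only [Fin.val_castLE] at this
    omega
  rw [hitSurv, if_neg hne, ← killed_pow_mulVec_one]
  simp [mulVec, dotProduct]

end BDChain

/-- Lemma `l-meanvar`.  If `β^{(i)}_1,…,β^{(i)}_i` are the eigenvalues of
the principal submatrix of `I − K` indexed by `{0,…,i−1}`, then they lie in `(0,2)` and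
`E_0 τ_i = E_0 τ̃_i = Σ_j 1/β_j`, `Var_0 τ_i = Σ_j (1−β_j)/β_j²`, `Var_0 τ̃_i = Σ_j 1/β_j²`. -/
theorem birth_death_hitting_time_eigenvalues
    {n : ℕ} (c : BDChain n) (i : Fin (n + 1)) (hi : i ≠ 0)
    (β : Fin (i : ℕ) → ℝ)
    (hβ : (c.subIK i).charpoly = ∏ j, (Polynomial.X - Polynomial.C (β j))) :
    (∀ j, β j ∈ Set.Ioo (0 : ℝ) 2) ∧
    c.hitMean i 0 = ∑ j, (β j)⁻¹ ∧
    c.hitMeanC i 0 = ∑ j, (β j)⁻¹ ∧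
    c.hitVar i 0 = ∑ j, (1 - β j) / (β j) ^ 2 ∧
    c.hitVarC i 0 = ∑ j, ((β j) ^ 2)⁻¹ := by
  have hi0 : 0 < (i : ℕ) := Nat.pos_of_ne_zero fun h => hi (Fin.ext h)
  have hQ := c.subK_nonneg i
  obtain ⟨h, r, hr0, hr1, hone, hh⟩ := exists_superharmonic_of_pow_mulVec_one_lt hQ hi0.ne'
    (pow_mulVec_one_lt_one hQ (c.subK_mulVec_one_le i)
      (fun _ => c.subK_mulVec_one_lt i) (fun _ _ => c.subK_pos i))
  have hS := c.subIK_eq_one_sub_subK i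
  have hβ_mem : ∀ j, β j ∈ Set.Ioo (0 : ℝ) 2 := by
    intro j
    have hdet : (Matrix.scalar _ (β j) - c.subIK i).det = 0 := by
      rw [← Matrix.eval_charpoly, hβ, Polynomial.eval_prod]
      exact Finset.prod_eq_zero (Finset.mem_univ j) (by simp)
    obtain ⟨v, hv, hv0⟩ := Matrix.exists_mulVec_eq_zero_iff.2 hdet
    have hl : c.subK i *ᵥ v = (1 - β j) • v := by
      have : β j • v - (v - c.subK i *ᵥ v) = 0 := by
        simpa [hS, sub_mulVec, ← smul_one_eq_diagonal, smul_mulVec] using hv0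
      rw [sub_smul, one_smul, ← sub_eq_zero, ← this]
      abel
    have habs := (abs_le_of_mulVec_eq_smul hQ (fun a => zero_lt_one.trans_le (hone a)) hh hv
      hl).trans_lt hr1
    rw [abs_lt] at habs
    constructor <;> linarith
  have hβ0 : ∀ j ∈ Finset.univ, β j ≠ 0 := fun j _ => (hβ_mem j).1.ne'
  have hsum := summable_pow_mulVec_one hQ hr0 hr1 hone hh
  have hsum' := summable_mul_pow_mulVec_one hQ hr0 hr1 hone hh
  have hu := one_sub_mulVec_tsum hsum
  have hw := one_sub_mulVec_tsum_succ_mul hsum hsum'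
  rw [← hS] at hu hw
  have htri : ∀ a b : Fin (i : ℕ), (a : ℕ) + 1 < b → c.subIK i a b = 0 := fun a b hab => by
    have hne : a ≠ b := by rintro rfl; omega
    rw [hS, Matrix.sub_apply, Matrix.one_apply_ne hne, c.subK_eq_zero i hab, sub_zero]
  have hrow : ∀ a : Fin (i : ℕ), (a : ℕ) + 1 < i → (c.subIK i *ᵥ 1) a = 0 := fun a ha => by
    rw [hS, sub_mulVec, one_mulVec, Pi.sub_apply, c.subK_mulVec_one_eq i ha, Pi.one_apply,
      sub_self]
  have hsurv : c.hitSurv i 0 = fun m => (c.subK i ^ m *ᵥ 1) ⟨0, hi0⟩ := by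
    funext m
    exact c.hitSurv_castLE i m ⟨0, hi0⟩
  have e1 := coeff_zero_mul_add_coeff_one hi0 htri hrow hu
  have e2 := coeff_zero_mul_add_coeff_one_mul_add_coeff_two hi0 htri hrow hu hw
  have hc0 := coeff_zero_prod_X_sub_C_ne_zero _ β hβ0
  rw [hβ, coeff_one_prod_X_sub_C _ β hβ0] at e1 e2
  rw [coeff_two_prod_X_sub_C _ β hβ0] at e2
  have hs0 : ∀ m, 0 ≤ c.hitSurv i 0 m := fun m => by
    rw [hsurv]
    exact pow_mulVec_nonneg hQ zero_le_one m _
  have hs : Summable (c.hitSurv i 0) := hsurv ▸ hsum _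
  have hsm : Summable fun m : ℕ => (m : ℝ) * c.hitSurv i 0 m := hsurv ▸ hsum' _
  have hs1 : Summable fun m : ℕ => ((m : ℝ) + 1) * c.hitSurv i 0 m := by
    simpa only [add_mul, one_mul] using hsm.add hs
  have hu0 : ∑' m, c.hitSurv i 0 m = ∑ j, (β j)⁻¹ := by
    rw [hsurv]
    refine mul_left_cancel₀ hc0 ?_
    linear_combination e1
  have hw0 : ∑' m : ℕ, ((m : ℝ) + 1) * c.hitSurv i 0 m =
      ((∑ j, (β j)⁻¹) ^ 2 + ∑ j, ((β j) ^ 2)⁻¹) / 2 := by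
    simp only [hsurv] at hu0 ⊢
    rw [hu0] at e2
    refine mul_left_cancel₀ hc0 ?_
    linear_combination e2
  have hmeanC : c.hitMeanC i 0 = ∑ j, (β j)⁻¹ := (integral_tsum_poisson hs0 hs).trans hu0
  refine ⟨hβ_mem, hu0, hmeanC, ?_, ?_⟩
  · have hsplit : ∑' m : ℕ, (2 * (m : ℝ) + 1) * c.hitSurv i 0 m =
        2 * ∑' m : ℕ, ((m : ℝ) + 1) * c.hitSurv i 0 m - ∑' m, c.hitSurv i 0 m := by
      rw [← tsum_mul_left, ← (hs1.mul_left 2).tsum_sub hs]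
      congr! 2 with m
      ring
    have hright : ∑ j, (1 - β j) / (β j) ^ 2 = ∑ j, ((β j) ^ 2)⁻¹ - ∑ j, (β j)⁻¹ := by
      rw [← Finset.sum_sub_distrib]
      refine Finset.sum_congr rfl fun j hj => ?_
      have := hβ0 j hj
      field_simp
    rw [BDChain.hitVar, BDChain.hitMean, hsplit, hw0, hu0, hright]
    ring
  · rw [BDChain.hitVarC, hmeanC]
    simp only [BDChain.hitSurvC]
    rw [integral_mul_tsum_poisson hs0 hs1, hw0]
    ring

end
end
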